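/- arXiv:1512.00419 — 5 statements merged into one kernel-verified Lean document; each statement's English description precedes it below -/
import Mathlib

section
/- Let G ∈ ℝ^{n×m} be a real matrix. Then sup over a ∈ [-1,1]ⁿ and b ∈ [-1,1]ᵐ of |Σ_{x,y} G_{xy} a_x b_y| is at most sup over complex vectors a ∈ ℂⁿ, b ∈ ℂᵐ with |a_x| ≤ 1 and |b_y| ≤ 1 for all x,y of |Σ_{x,y} G_{xy} a_x b_y|, and the latter is at most √2 times the former. -/
/-- The norm of a real matrix `G` as a bilinear form on real `ℓ∞ⁿ × ℓ∞ᵐ`: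
the supremum of `|Σ_{x,y} G_{xy} a_x b_y|` over sign vectors `a ∈ [-1,1]ⁿ`, `b ∈ [-1,1]ᵐ`. -/
noncomputable def realBilinNorm (n m : ℕ) (G : Matrix (Fin n) (Fin m) ℝ) : ℝ :=
  sSup {r : ℝ | ∃ (a : Fin n → ℝ) (b : Fin m → ℝ),
    (∀ x, |a x| ≤ 1) ∧ (∀ y, |b y| ≤ 1) ∧
    r = |∑ x, ∑ y, G x y * a x * b y|}

/-- The norm of a real matrix `G` as a bilinear form on complex `ℓ∞ⁿ × ℓ∞ᵐ`:
the supremum of `|Σ_{x,y} G_{xy} a_x b_y|` over complex vectors with entries of modulus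
at most `1`. -/
noncomputable def complexBilinNorm (n m : ℕ) (G : Matrix (Fin n) (Fin m) ℝ) : ℝ :=
  sSup {r : ℝ | ∃ (a : Fin n → ℂ) (b : Fin m → ℂ),
    (∀ x, ‖a x‖ ≤ 1) ∧ (∀ y, ‖b y‖ ≤ 1) ∧
    r = ‖∑ x, ∑ y, (G x y : ℂ) * a x * b y‖}

open Real MeasureTheory

noncomputable def triT (θ : ℝ) : ℝ :=
  ∑' n : ℕ, 8 / π ^ 2 / (2 * (n : ℝ) + 1) ^ 2 * Real.cos ((2 * (n : ℝ) + 1) * θ)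

lemma hasSum_cg {f g : ℕ → ℝ} {a : ℝ} (h : ∀ n, f n = g n) : HasSum f a ↔ HasSum g a := by
  rw [funext h]

noncomputable def sqw (t : ℝ) : ℝ := Real.sign (Real.sin t)

lemma summable_odd : Summable (fun n : ℕ => 8 / π ^ 2 / (2 * (n : ℝ) + 1) ^ 2) := by
  have h := hasSum_zeta_two.summable
  have h2 : Summable (fun n : ℕ => (1 : ℝ) / ((2 * n + 1 : ℕ) : ℝ) ^ 2) :=
    h.comp_injective (i := fun n : ℕ => 2 * n + 1) (fun a b hab => by simpa using hab)
  refine (h2.mul_left (8 / π ^ 2)).congr (fun n => ?_)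
  push_cast
  ring

lemma term_bound (n : ℕ) (x : ℝ) :
    ‖8 / π ^ 2 / (2 * (n : ℝ) + 1) ^ 2 * Real.cos x‖ ≤ 8 / π ^ 2 / (2 * (n : ℝ) + 1) ^ 2 := by
  rw [norm_mul, Real.norm_of_nonneg (by positivity)]
  exact mul_le_of_le_one_right (by positivity) (Real.abs_cos_le_one x)

lemma summable_tri (θ : ℝ) : Summable (fun n : ℕ =>
    8 / π ^ 2 / (2 * (n : ℝ) + 1) ^ 2 * Real.cos ((2 * (n : ℝ) + 1) * θ)) :=
  Summable.of_norm_bounded summable_odd (fun n => term_bound n _)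

lemma continuous_triT : Continuous triT :=
  continuous_tsum (fun n => by fun_prop) summable_odd (fun n x => term_bound n _)

lemma triT_neg (θ : ℝ) : triT (-θ) = triT θ := by
  unfold triT
  congr 1; ext n
  rw [mul_neg, Real.cos_neg]

lemma triT_periodic : Function.Periodic triT (2 * π) := by
  intro θ
  unfold triT
  congr 1; ext n
  have : (2 * (n : ℝ) + 1) * (θ + 2 * π) = (2 * (n : ℝ) + 1) * θ + ((2 * n + 1 : ℕ) : ℝ) * (2 * π) := by
    push_cast; ring
  rw [this, Real.cos_add_nat_mul_two_pi]

lemma quad_sum {x : ℝ} (hx : x ∈ Set.Icc (0 : ℝ) 1) :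
    HasSum (fun n : ℕ => 1 / (n : ℝ) ^ 2 * Real.cos (2 * π * n * x))
      (π ^ 2 * (x ^ 2 - x + 6⁻¹)) := by
  have h := hasSum_one_div_nat_pow_mul_cos (k := 1) one_ne_zero hx
  have h2 := bernoulliFun_two x
  unfold bernoulliFun at h2
  have e : (Polynomial.map (algebraMap ℚ ℝ) (Polynomial.bernoulli (2 * 1))).eval x
      = x ^ 2 - x + 6⁻¹ := by
    rw [← h2]
  rw [e] at h
  have e2 : (-1 : ℝ) ^ (1 + 1) * (2 * π) ^ (2 * 1) / 2 / ((2 * 1).factorial : ℕ) = π ^ 2 := by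
    norm_num [Nat.factorial]
    ring
  rw [e2] at h
  exact h

lemma triT_eq {θ : ℝ} (h0 : 0 ≤ θ) (h1 : θ ≤ π) : triT θ = 1 - 2 * θ / π := by
  have hp := Real.pi_pos
  set x := θ / (2 * π) with hx
  have hxθ : 2 * π * x = θ := by rw [hx]; field_simp
  have hx0 : 0 ≤ x := by positivity
  have hx1 : x ≤ 1 / 2 := by
    rw [hx, div_le_iff₀ (by positivity)]; linarith
  have A := quad_sum (x := x) ⟨hx0, by linarith⟩
  have B := quad_sum (x := 2 * x) ⟨by linarith, by linarith⟩
  have C : HasSum (fun n : ℕ => 1 / ((2 * n : ℕ) : ℝ) ^ 2 * Real.cos (2 * π * (2 * n : ℕ) * x))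
      (1 / 4 * (π ^ 2 * ((2 * x) ^ 2 - 2 * x + 6⁻¹))) := by
    refine (hasSum_cg (fun n => ?_)).mp (B.mul_left (1 / 4))
    rw [show 2 * π * ((2 * n : ℕ) : ℝ) * x = 2 * π * n * (2 * x) by push_cast; ring]
    push_cast; ring
  have D := (((summable_tri θ).hasSum).mul_left (π ^ 2 / 8))
  have D' : HasSum (fun n : ℕ => 1 / ((2 * n + 1 : ℕ) : ℝ) ^ 2 *
      Real.cos (2 * π * (2 * n + 1 : ℕ) * x)) (π ^ 2 / 8 * triT θ) := by
    refine (hasSum_cg (fun n => ?_)).mp D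
    have : 2 * π * ((2 * n + 1 : ℕ) : ℝ) * x = (2 * (n : ℝ) + 1) * θ := by
      rw [← hxθ]; push_cast; ring
    rw [this]; push_cast; field_simp
  have E := (HasSum.even_add_odd (f := fun n : ℕ => 1 / (n : ℝ) ^ 2 * Real.cos (2 * π * n * x))
    C D').unique A
  have hpi : π ≠ 0 := hp.ne'
  have : triT θ = 1 - 4 * x := by
    have h2 : π ^ 2 * (triT θ - (1 - 4 * x)) = 0 := by linarith
    have := (mul_eq_zero.mp h2).resolve_left (by positivity)
    linarith
  rw [this, hx]; field_simp; ring

lemma sqw_abs (t : ℝ) : |sqw t| ≤ 1 := by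
  unfold sqw
  rcases Real.sign_apply_eq (Real.sin t) with h | h | h <;> rw [h] <;> norm_num

lemma sqw_meas : Measurable sqw := by
  unfold sqw Real.sign
  exact Measurable.ite (measurableSet_lt Real.measurable_sin measurable_const) measurable_const
    (Measurable.ite (measurableSet_lt measurable_const Real.measurable_sin) measurable_const
      measurable_const)

lemma sqw_add_pi (t : ℝ) : sqw (t + π) = - sqw t := by
  unfold sqw; rw [Real.sin_add_pi, Real.sign_neg]

lemma sqw_per (t : ℝ) : sqw (t + 2 * π) = sqw t := by
  unfold sqw; rw [Real.sin_add_two_pi]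

lemma sqw_pos {t : ℝ} (h0 : 0 < t) (h1 : t < π) : sqw t = 1 :=
  Real.sign_of_pos (Real.sin_pos_of_pos_of_lt_pi h0 h1)

lemma sqw_int (c d a b : ℝ) : IntervalIntegrable (fun t => sqw (t + c) * sqw (t + d)) volume a b := by
  have hm : Measurable (fun t => sqw (t + c) * sqw (t + d)) :=
    (sqw_meas.comp (measurable_id.add_const c)).mul (sqw_meas.comp (measurable_id.add_const d))
  refine (intervalIntegrable_const (c := (1 : ℝ))).mono_fun hm.aestronglyMeasurable ?_
  refine Filter.Eventually.of_forall (fun t => ?_)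
  simp only
  rw [norm_mul, norm_one]
  exact mul_le_one₀ (sqw_abs _) (norm_nonneg _) (sqw_abs _)

lemma sqw_corr_per (c d : ℝ) : Function.Periodic (fun t => sqw (t + c) * sqw (t + d)) (2 * π) := by
  intro t
  simp only
  rw [show t + 2 * π + c = t + c + 2 * π by ring, show t + 2 * π + d = t + d + 2 * π by ring,
    sqw_per, sqw_per]

lemma sqw_shift (c d : ℝ) : ∫ t in (0 : ℝ)..(2 * π), sqw (t + c) * sqw (t + d)
    = ∫ t in (0 : ℝ)..(2 * π), sqw t * sqw (t + (d - c)) := by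
  have h := intervalIntegral.integral_comp_add_right (a := 0) (b := 2 * π)
    (fun t => sqw t * sqw (t + (d - c))) c
  have e : ∀ t, t + c + (d - c) = t + d := fun t => by ring
  simp only [e] at h
  rw [h]
  have h2 := (sqw_corr_per 0 (d - c)).intervalIntegral_add_eq c 0
  simp only [add_zero, zero_add] at h2
  rw [zero_add, add_comm (2 * π) c]; exact h2

lemma tri_int (θ : ℝ) : ∫ t in (0 : ℝ)..(2 * π), sqw t * sqw (t + θ) = 2 * π * triT θ := by
  have hp := Real.pi_pos
  set D : ℝ → ℝ := fun θ => (∫ t in (0 : ℝ)..(2 * π), sqw t * sqw (t + θ)) - 2 * π * triT θ with hD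
  have base : ∀ θ, 0 ≤ θ → θ ≤ π → D θ = 0 := by
    intro θ h0 h1
    have I1 : ∫ t in (0 : ℝ)..(π - θ), sqw t * sqw (t + θ) = π - θ := by
      rw [intervalIntegral.integral_congr_Ioo_of_le (g := fun _ => (1 : ℝ)) (by linarith)]
      · simp
      · intro t ht
        simp only
        rw [sqw_pos ht.1 (by linarith [ht.2]), sqw_pos (by linarith [ht.1]) (by linarith [ht.2]), one_mul]
    have I2 : ∫ t in (π - θ)..π, sqw t * sqw (t + θ) = - θ := by
      rw [intervalIntegral.integral_congr_Ioo_of_le (g := fun _ => (-1 : ℝ)) (by linarith)]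
      · simp
      · intro t ht
        simp only
        rw [sqw_pos (by linarith [ht.1]) ht.2, show t + θ = (t + θ - π) + π by ring, sqw_add_pi,
          sqw_pos (by linarith [ht.1]) (by linarith [ht.2]), one_mul]
    have ii : ∀ a b, IntervalIntegrable (fun t => sqw t * sqw (t + θ)) volume a b := fun a b => by
      simpa using sqw_int 0 θ a b
    have I3 : ∫ t in (0 : ℝ)..π, sqw t * sqw (t + θ) = π - 2 * θ := by
      rw [← intervalIntegral.integral_add_adjacent_intervals (ii 0 (π - θ)) (ii _ _), I1, I2]; ring
    have I4 : ∫ t in π..(2 * π), sqw t * sqw (t + θ) = π - 2 * θ := by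
      rw [← I3]
      have h := intervalIntegral.integral_comp_add_right (a := 0) (b := π)
        (fun t => sqw t * sqw (t + θ)) π
      rw [zero_add, ← two_mul] at h
      rw [← h]
      congr 1; ext t
      rw [show t + π + θ = t + θ + π by ring, sqw_add_pi, sqw_add_pi]; ring
    simp only [hD]
    rw [← intervalIntegral.integral_add_adjacent_intervals (ii 0 π) (ii _ _), I3, I4, triT_eq h0 h1]
    field_simp; ring
  have per : Function.Periodic D (2 * π) := by
    intro θ
    simp only [hD, triT_periodic θ, ← add_assoc, sqw_per]
  have ev : ∀ θ, D (-θ) = D θ := by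
    intro θ
    simp only [hD, triT_neg]
    congr 1
    have := sqw_shift θ 0
    simp only [add_zero, zero_sub] at this
    rw [← this]
    congr 1; ext t; ring
  obtain ⟨y, hy, e⟩ := per.exists_mem_Ico₀ (by positivity) θ
  have : D y = 0 := by
    by_cases h : y ≤ π
    · exact base y hy.1 h
    · have h1 := per (-y)
      rw [ev] at h1
      rw [← h1]
      exact base _ (by linarith [hy.2]) (by linarith [hy.2])
  have h3 : D θ = 0 := by rw [e, this]
  simp only [hD] at h3
  linarith

noncomputable def kc (n : ℕ) : ℝ :=
  8 / π ^ 2 / (2 * (n : ℝ) + 1) ^ 2 *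
    (-4 * Real.cos ((2 * (n : ℝ) + 1) * (π / 4)) / ((2 * (n : ℝ) + 1) ^ 2 - 4))

noncomputable def KK (θ : ℝ) : ℝ := ∫ u in (-(π / 4))..(π / 4), Real.cos (2 * u) * triT (θ - u)

lemma odd_sq_ne (n : ℕ) : (2 * (n : ℝ) + 1) - 2 ≠ 0 := by
  intro h
  have : (2 * (n : ℤ) + 1) - 2 = 0 := by exact_mod_cast h
  omega

lemma elem_int (n : ℕ) (θ : ℝ) :
    ∫ u in (-(π / 4))..(π / 4), Real.cos (2 * u) * Real.cos ((2 * (n : ℝ) + 1) * (θ - u))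
    = (-4 * Real.cos ((2 * (n : ℝ) + 1) * (π / 4)) / ((2 * (n : ℝ) + 1) ^ 2 - 4)) *
      Real.cos ((2 * (n : ℝ) + 1) * θ) := by
  set j : ℝ := 2 * (n : ℝ) + 1 with hj
  have hm : j - 2 ≠ 0 := odd_sq_ne n
  have hpl : j + 2 ≠ 0 := by positivity
  have hd : ∀ u ∈ Set.uIcc (-(π / 4)) (π / 4), HasDerivAt
      (fun u => (-1 / 2) * (Real.sin (j * θ - (j - 2) * u) / (j - 2)
        + Real.sin (j * θ - (j + 2) * u) / (j + 2)))
      (Real.cos (2 * u) * Real.cos (j * (θ - u))) u := by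
    intro u _
    have d1 : HasDerivAt (fun u => j * θ - (j - 2) * u) (-(j - 2)) u := by
      simpa using ((hasDerivAt_id u).const_mul (j - 2)).const_sub (j * θ)
    have d2 : HasDerivAt (fun u => j * θ - (j + 2) * u) (-(j + 2)) u := by
      simpa using ((hasDerivAt_id u).const_mul (j + 2)).const_sub (j * θ)
    have := ((d1.sin.div_const (j - 2)).add (d2.sin.div_const (j + 2))).const_mul (-1 / 2)
    refine this.congr_deriv ?_
    rw [show j * θ - (j - 2) * u = j * (θ - u) + 2 * u by ring,
      show j * θ - (j + 2) * u = j * (θ - u) - 2 * u by ring, Real.cos_add, Real.cos_sub]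
    field_simp
    ring
  rw [intervalIntegral.integral_eq_sub_of_hasDerivAt hd (by
    apply Continuous.intervalIntegrable; fun_prop)]
  rw [show j * θ - (j - 2) * (π / 4) = (j * θ - j * (π / 4)) + π / 2 by ring,
    show j * θ - (j + 2) * (π / 4) = (j * θ - j * (π / 4)) - π / 2 by ring,
    show j * θ - (j - 2) * (-(π / 4)) = (j * θ + j * (π / 4)) - π / 2 by ring,
    show j * θ - (j + 2) * (-(π / 4)) = (j * θ + j * (π / 4)) + π / 2 by ring,
    Real.sin_add_pi_div_two, Real.sin_add_pi_div_two, Real.sin_sub_pi_div_two,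
    Real.sin_sub_pi_div_two, Real.cos_add, Real.cos_sub]
  rw [show j ^ 2 - 4 = (j - 2) * (j + 2) by ring]
  field_simp
  ring

lemma hasSum_KK (θ : ℝ) :
    HasSum (fun n : ℕ => kc n * Real.cos ((2 * (n : ℝ) + 1) * θ)) (KK θ) := by
  have h := intervalIntegral.hasSum_integral_of_dominated_convergence
    (μ := volume) (a := -(π / 4)) (b := π / 4)
    (F := fun (n : ℕ) (u : ℝ) => Real.cos (2 * u) *
      (8 / π ^ 2 / (2 * (n : ℝ) + 1) ^ 2 * Real.cos ((2 * (n : ℝ) + 1) * (θ - u))))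
    (f := fun u => Real.cos (2 * u) * triT (θ - u))
    (fun n _ => 8 / π ^ 2 / (2 * (n : ℝ) + 1) ^ 2)
    (fun n => (by fun_prop : Continuous _).aestronglyMeasurable)
    (fun n => Filter.Eventually.of_forall fun u _ => by
      rw [norm_mul]
      exact (mul_le_of_le_one_left (norm_nonneg _) (Real.abs_cos_le_one _)).trans (term_bound n _))
    (Filter.Eventually.of_forall fun u _ => summable_odd)
    intervalIntegrable_const
    (Filter.Eventually.of_forall fun u _ => (summable_tri (θ - u)).hasSum.mul_left _)
  refine (hasSum_cg (fun n => ?_)).mp h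
  symm
  unfold kc
  rw [mul_assoc, ← elem_int, ← intervalIntegral.integral_const_mul]
  congr 1; ext u; ring

lemma int_cos2 : ∫ u in (-(π / 4))..(π / 4), Real.cos (2 * u) = 1 := by
  rw [intervalIntegral.integral_comp_mul_left _ (by norm_num : (2 : ℝ) ≠ 0)]
  rw [integral_cos, show 2 * (π / 4) = π / 2 by ring, show 2 * (-(π / 4)) = -(π / 2) by ring,
    Real.sin_neg, Real.sin_pi_div_two]
  norm_num

lemma KK_quarter : KK (π / 4) = 1 / 2 := by
  have hp := Real.pi_pos
  have e : KK (π / 4) = ∫ u in (-(π / 4))..(π / 4),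
      (Real.cos (2 * u) * (1 / 2) + 2 / π * (u * Real.cos (2 * u))) := by
    unfold KK
    apply intervalIntegral.integral_congr
    intro u hu
    rw [Set.uIcc_of_le (by linarith)] at hu
    simp only
    rw [triT_eq (by linarith [hu.2]) (by linarith [hu.1])]
    field_simp; ring
  have z : ∫ u in (-(π / 4))..(π / 4), u * Real.cos (2 * u) = 0 := by
    have h := intervalIntegral.integral_comp_neg (a := -(π / 4)) (b := π / 4)
      (fun u => u * Real.cos (2 * u))
    simp only [neg_neg, mul_neg, Real.cos_neg, neg_mul, intervalIntegral.integral_neg] at h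
    linarith
  rw [e, intervalIntegral.integral_add (Continuous.intervalIntegrable (by fun_prop) _ _)
    (Continuous.intervalIntegrable (by fun_prop) _ _), intervalIntegral.integral_mul_const,
    intervalIntegral.integral_const_mul, int_cos2, z]
  norm_num

lemma cos_odd_sq (n : ℕ) : Real.cos ((2 * (n : ℝ) + 1) * (π / 4)) ^ 2 = 1 / 2 := by
  rw [Real.cos_sq, show 2 * ((2 * (n : ℝ) + 1) * (π / 4)) = n * π + π / 2 by ring,
    Real.cos_add_pi_div_two, Real.sin_nat_mul_pi]
  norm_num

lemma kc_cos (n : ℕ) : kc n * Real.cos ((2 * (n : ℝ) + 1) * (π / 4)) =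
    -(16 / π ^ 2) / (2 * (n : ℝ) + 1) ^ 2 / ((2 * (n : ℝ) + 1) ^ 2 - 4) := by
  have h := cos_odd_sq n
  unfold kc
  set c := Real.cos ((2 * (n : ℝ) + 1) * (π / 4))
  calc _ = 8 / π ^ 2 / (2 * (n : ℝ) + 1) ^ 2 * (-4 / ((2 * (n : ℝ) + 1) ^ 2 - 4)) * c ^ 2 := by ring
    _ = _ := by rw [h]; ring

lemma abs_kc (n : ℕ) : |kc (n + 1)| =
    -√2 * (kc (n + 1) * Real.cos ((2 * ((n + 1 : ℕ) : ℝ) + 1) * (π / 4))) := by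
  have hc : |Real.cos ((2 * ((n + 1 : ℕ) : ℝ) + 1) * (π / 4))| = 1 / √2 := by
    rw [← Real.sqrt_sq_eq_abs, cos_odd_sq, Real.sqrt_div zero_le_one, Real.sqrt_one]
  have hneg : kc (n + 1) * Real.cos ((2 * ((n + 1 : ℕ) : ℝ) + 1) * (π / 4)) ≤ 0 := by
    rw [kc_cos]
    have : 0 ≤ (2 * ((n + 1 : ℕ) : ℝ) + 1) ^ 2 - 4 := by
      push_cast
      nlinarith [(Nat.cast_nonneg n : (0 : ℝ) ≤ n)]
    rw [neg_div, neg_div, Left.neg_nonpos_iff]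
    positivity
  have := abs_of_nonpos hneg
  rw [abs_mul, hc] at this
  have h2 : √2 ≠ 0 := by positivity
  rw [neg_mul, ← mul_neg, ← this]
  field_simp

lemma sum_abs_kc : HasSum (fun n : ℕ => |kc (n + 1)|) (kc 0 - 1 / √2) := by
  have h := hasSum_KK (π / 4)
  rw [KK_quarter, ← hasSum_nat_add_iff' 1] at h
  simp only [abs_kc]
  have h' := h.mul_left (-√2)
  have h2 : √2 * √2 = 2 := Real.mul_self_sqrt (by norm_num)
  simp only [Finset.range_one, Finset.sum_singleton, Nat.cast_zero, mul_zero, zero_add, one_mul,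
    Real.cos_pi_div_four] at h'
  rwa [show -√2 * (1 / 2 - kc 0 * (√2 / 2)) = kc 0 - 1 / √2 by
    field_simp
    rw [Real.sq_sqrt (by norm_num)]
    ring] at h'

lemma kc_zero : 0 < kc 0 := by
  have := sum_abs_kc.nonneg (fun n => abs_nonneg _)
  have h2 : 0 < 1 / √2 := by positivity
  linarith

section main
variable {n m : ℕ} (G : Matrix (Fin n) (Fin m) ℝ)

lemma real_le (a : Fin n → ℝ) (b : Fin m → ℝ) (ha : ∀ x, |a x| ≤ 1) (hb : ∀ y, |b y| ≤ 1) :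
    |∑ x, ∑ y, G x y * a x * b y| ≤ realBilinNorm n m G := by
  refine le_csSup ⟨∑ x, ∑ y, |G x y|, ?_⟩ ⟨a, b, ha, hb, rfl⟩
  rintro r ⟨a, b, ha, hb, rfl⟩
  refine (Finset.abs_sum_le_sum_abs _ _).trans (Finset.sum_le_sum fun x _ => ?_)
  refine (Finset.abs_sum_le_sum_abs _ _).trans (Finset.sum_le_sum fun y _ => ?_)
  rw [abs_mul, abs_mul, mul_assoc]
  exact mul_le_of_le_one_right (abs_nonneg _) (mul_le_one₀ (ha x) (abs_nonneg _) (hb y))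

lemma complex_le (a : Fin n → ℂ) (b : Fin m → ℂ) (ha : ∀ x, ‖a x‖ ≤ 1) (hb : ∀ y, ‖b y‖ ≤ 1) :
    ‖∑ x, ∑ y, (G x y : ℂ) * a x * b y‖ ≤ complexBilinNorm n m G := by
  refine le_csSup ⟨∑ x, ∑ y, |G x y|, ?_⟩ ⟨a, b, ha, hb, rfl⟩
  rintro r ⟨a, b, ha, hb, rfl⟩
  refine (norm_sum_le _ _).trans (Finset.sum_le_sum fun x _ => ?_)
  refine (norm_sum_le _ _).trans (Finset.sum_le_sum fun y _ => ?_)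
  rw [norm_mul, norm_mul, mul_assoc, Complex.norm_real, Real.norm_eq_abs]
  exact mul_le_of_le_one_right (abs_nonneg _) (mul_le_one₀ (ha x) (norm_nonneg _) (hb y))

lemma tri_bound (α : Fin n → ℝ) (β : Fin m → ℝ) :
    |∑ x, ∑ y, G x y * triT (α x - β y)| ≤ realBilinNorm n m G := by
  have hp := Real.pi_pos
  have e : 2 * π * ∑ x, ∑ y, G x y * triT (α x - β y) =
      ∫ t in (0 : ℝ)..(2 * π), ∑ x, ∑ y, G x y * (sqw (t + β y) * sqw (t + α x)) := by
    rw [intervalIntegral.integral_finsetSum]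
    · rw [Finset.mul_sum]
      refine Finset.sum_congr rfl fun x _ => ?_
      rw [intervalIntegral.integral_finsetSum]
      · rw [Finset.mul_sum]
        refine Finset.sum_congr rfl fun y _ => ?_
        rw [intervalIntegral.integral_const_mul, sqw_shift, tri_int]
        ring
      · intro y _
        exact (sqw_int _ _ _ _).const_mul _
    · intro x _
      have := IntervalIntegrable.sum (μ := volume) (a := 0) (b := 2 * π) Finset.univ
        (f := fun (y : Fin m) t => G x y * (sqw (t + β y) * sqw (t + α x)))
        (fun y _ => (sqw_int _ _ _ _).const_mul _)
      refine this.congr_ae (Filter.Eventually.of_forall fun t => ?_)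
      simp only [Finset.sum_apply]
  have h := intervalIntegral.norm_integral_le_of_norm_le_const (a := 0) (b := 2 * π)
    (C := realBilinNorm n m G)
    (f := fun t => ∑ x, ∑ y, G x y * (sqw (t + β y) * sqw (t + α x))) (fun t _ => by
      have := real_le G (fun x => sqw (t + α x)) (fun y => sqw (t + β y))
        (fun x => sqw_abs _) (fun y => sqw_abs _)
      rw [Real.norm_eq_abs]
      convert this using 4
      ring)
  rw [← e, Real.norm_eq_abs, abs_mul, sub_zero, abs_of_pos (by positivity : 0 < 2 * π),
    mul_comm] at h
  exact le_of_mul_le_mul_right h (by positivity)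

lemma KK_bound (α : Fin n → ℝ) (β : Fin m → ℝ) :
    ∑ x, ∑ y, G x y * KK (α x - β y) ≤ realBilinNorm n m G := by
  have hp := Real.pi_pos
  have hc := continuous_triT
  have e : ∑ x, ∑ y, G x y * KK (α x - β y) =
      ∫ u in (-(π / 4))..(π / 4),
        Real.cos (2 * u) * ∑ x, ∑ y, G x y * triT ((α x - u) - β y) := by
    simp only [Finset.mul_sum]
    rw [intervalIntegral.integral_finsetSum]
    · refine Finset.sum_congr rfl fun x _ => ?_
      rw [intervalIntegral.integral_finsetSum]
      · refine Finset.sum_congr rfl fun y _ => ?_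
        unfold KK
        rw [← intervalIntegral.integral_const_mul]
        congr 1; ext u
        rw [show α x - u - β y = α x - β y - u by ring]
        ring
      · intro y _
        exact Continuous.intervalIntegrable (by fun_prop) _ _
    · intro x _
      exact Continuous.intervalIntegrable (by fun_prop) _ _
  rw [e]
  have := intervalIntegral.integral_mono_on (μ := volume) (a := -(π / 4)) (b := π / 4)
    (f := fun u => Real.cos (2 * u) * ∑ x, ∑ y, G x y * triT ((α x - u) - β y))
    (g := fun u => Real.cos (2 * u) * realBilinNorm n m G) (by linarith)
    (Continuous.intervalIntegrable (by fun_prop) _ _)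
    (Continuous.intervalIntegrable (by fun_prop) _ _)
    (fun u hu => mul_le_mul_of_nonneg_left
      ((le_abs_self _).trans (tri_bound G (fun x => α x - u) β))
      (Real.cos_nonneg_of_mem_Icc ⟨by linarith [hu.1], by linarith [hu.2]⟩))
  rwa [intervalIntegral.integral_mul_const, int_cos2, one_mul] at this

lemma cos_re (α : Fin n → ℝ) (β : Fin m → ℝ) :
    ∑ x, ∑ y, G x y * Real.cos (α x - β y) =
      (∑ x, ∑ y, (G x y : ℂ) * Complex.exp (α x * Complex.I)
        * Complex.exp ((-β y : ℝ) * Complex.I)).re := by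
  rw [Complex.re_sum]
  refine Finset.sum_congr rfl fun x _ => ?_
  rw [Complex.re_sum]
  refine Finset.sum_congr rfl fun y _ => ?_
  rw [mul_assoc, ← Complex.exp_add, ← add_mul, ← Complex.ofReal_add, Complex.re_ofReal_mul,
    Complex.exp_ofReal_mul_I_re, sub_eq_add_neg]

lemma cos_bound (α : Fin n → ℝ) (β : Fin m → ℝ) :
    |∑ x, ∑ y, G x y * Real.cos (α x - β y)| ≤ complexBilinNorm n m G := by
  rw [cos_re]
  exact (Complex.abs_re_le_norm _).trans (complex_le G _ _
    (fun x => (Complex.norm_exp_ofReal_mul_I _).le) (fun y => (Complex.norm_exp_ofReal_mul_I _).le))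

lemma key (α : Fin n → ℝ) (β : Fin m → ℝ) :
    kc 0 * ∑ x, ∑ y, G x y * Real.cos (α x - β y) ≤
      realBilinNorm n m G + (kc 0 - 1 / √2) * complexBilinNorm n m G := by
  have h : HasSum (fun k : ℕ => kc k * ∑ x, ∑ y, G x y *
      Real.cos ((2 * (k : ℝ) + 1) * (α x - β y))) (∑ x, ∑ y, G x y * KK (α x - β y)) := by
    have h1 : HasSum (fun k : ℕ => ∑ x, ∑ y, G x y *
        (kc k * Real.cos ((2 * (k : ℝ) + 1) * (α x - β y))))
        (∑ x, ∑ y, G x y * KK (α x - β y)) :=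
      hasSum_sum fun x _ => hasSum_sum fun y _ => (hasSum_KK _).mul_left _
    refine (hasSum_cg fun k => ?_).mp h1
    simp only [Finset.mul_sum]
    refine Finset.sum_congr rfl fun x _ => Finset.sum_congr rfl fun y _ => ?_
    ring
  rw [← hasSum_nat_add_iff' 1] at h
  simp only [Finset.range_one, Finset.sum_singleton, Nat.cast_zero, mul_zero, zero_add,
    one_mul] at h
  have h2 := hasSum_le (fun k => ?_) h.neg (sum_abs_kc.mul_right (complexBilinNorm n m G))
  · linarith [KK_bound G α β]
  · have := cos_bound G (fun x => (2 * ((k + 1 : ℕ) : ℝ) + 1) * α x)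
      (fun y => (2 * ((k + 1 : ℕ) : ℝ) + 1) * β y)
    simp only [← mul_sub] at this
    refine (neg_le_abs _).trans ?_
    rw [abs_mul]
    exact mul_le_mul_of_nonneg_left this (abs_nonneg _)

lemma uni_bound (α : Fin n → ℝ) (β : Fin m → ℝ) :
    kc 0 * ‖∑ x, ∑ y, (G x y : ℂ) * Complex.exp (α x * Complex.I)
        * Complex.exp (β y * Complex.I)‖ ≤
      realBilinNorm n m G + (kc 0 - 1 / √2) * complexBilinNorm n m G := by
  set z := ∑ x, ∑ y, (G x y : ℂ) * Complex.exp (α x * Complex.I)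
        * Complex.exp (β y * Complex.I) with hz
  have h := key G (fun x => α x - z.arg) (fun y => - β y)
  rw [cos_re] at h
  have e : ∑ x, ∑ y, (G x y : ℂ) * Complex.exp ((α x - z.arg : ℝ) * Complex.I)
        * Complex.exp ((-(-β y) : ℝ) * Complex.I) = (‖z‖ : ℂ) := by
    have h3 : (‖z‖ : ℂ) = z * Complex.exp (-(z.arg * Complex.I)) := by
      nth_rewrite 2 [← Complex.norm_mul_exp_arg_mul_I z]
      rw [mul_assoc, ← Complex.exp_add, add_neg_cancel, Complex.exp_zero, mul_one]
    rw [h3]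
    conv_rhs => rw [hz]
    simp only [Finset.sum_mul]
    refine Finset.sum_congr rfl fun x _ => Finset.sum_congr rfl fun y _ => ?_
    rw [neg_neg, Complex.ofReal_sub, sub_mul, sub_eq_add_neg, Complex.exp_add]
    ring
  rw [e, Complex.ofReal_re] at h
  exact h

lemma avg (z : ℂ) (hz : ‖z‖ ≤ 1) : ∃ p q : ℝ,
    z = (Complex.exp (p * Complex.I) + Complex.exp (q * Complex.I)) / 2 := by
  refine ⟨z.arg + Real.arccos ‖z‖, z.arg - Real.arccos ‖z‖, ?_⟩
  have hc : Complex.cos (Real.arccos ‖z‖ : ℝ) = (‖z‖ : ℂ) := by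
    rw [← Complex.ofReal_cos, Real.cos_arccos (by linarith [norm_nonneg z]) hz]
  rw [Complex.cos] at hc
  conv_lhs => rw [← Complex.norm_mul_exp_arg_mul_I z, ← hc]
  push_cast
  rw [add_mul, sub_mul, sub_eq_add_neg, Complex.exp_add, Complex.exp_add, neg_mul]
  ring

lemma full_bound (a : Fin n → ℂ) (b : Fin m → ℂ) (ha : ∀ x, ‖a x‖ ≤ 1) (hb : ∀ y, ‖b y‖ ≤ 1) :
    kc 0 * ‖∑ x, ∑ y, (G x y : ℂ) * a x * b y‖ ≤
      realBilinNorm n m G + (kc 0 - 1 / √2) * complexBilinNorm n m G := by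
  choose p q hpq using fun x => avg (a x) (ha x)
  choose r s hrs using fun y => avg (b y) (hb y)
  have h1 := uni_bound G p r
  have h2 := uni_bound G p s
  have h3 := uni_bound G q r
  have h4 := uni_bound G q s
  set F : (Fin n → ℝ) → (Fin m → ℝ) → ℂ := fun α β => ∑ x, ∑ y, (G x y : ℂ) *
    Complex.exp (α x * Complex.I) * Complex.exp (β y * Complex.I) with hF
  have e : ∑ x, ∑ y, (G x y : ℂ) * a x * b y = (F p r + F p s + F q r + F q s) / 4 := by
    simp only [hF, ← Finset.sum_add_distrib, Finset.sum_div]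
    refine Finset.sum_congr rfl fun x _ => Finset.sum_congr rfl fun y _ => ?_
    rw [hpq x, hrs y]
    ring
  have hn : ‖∑ x, ∑ y, (G x y : ℂ) * a x * b y‖ ≤
      (‖F p r‖ + ‖F p s‖ + ‖F q r‖ + ‖F q s‖) / 4 := by
    rw [e, norm_div]
    have := norm_add₄_le (a := F p r) (b := F p s) (c := F q r) (d := F q s)
    rw [show ‖(4 : ℂ)‖ = 4 by norm_num]
    linarith
  have := mul_le_mul_of_nonneg_left hn kc_zero.le
  linarith

end main

/-- the real bilinear norm is at most the complex one, which in turn is at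
most `√2` times the real one. -/
theorem stmt1 (n m : ℕ) (G : Matrix (Fin n) (Fin m) ℝ) :
    realBilinNorm n m G ≤ complexBilinNorm n m G ∧
    complexBilinNorm n m G ≤ Real.sqrt 2 * realBilinNorm n m G := by
  constructor
  · refine csSup_le ⟨_, 0, 0, by simp, by simp, rfl⟩ ?_
    rintro r ⟨a, b, ha, hb, rfl⟩
    have h := complex_le G (fun x => (a x : ℂ)) (fun y => (b y : ℂ))
      (fun x => by simpa using ha x) (fun y => by simpa using hb y)
    have e : ∑ x, ∑ y, (G x y : ℂ) * (a x : ℂ) * (b y : ℂ) =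
        ((∑ x, ∑ y, G x y * a x * b y : ℝ) : ℂ) := by push_cast; rfl
    rwa [e, Complex.norm_real, Real.norm_eq_abs] at h
  · have h : complexBilinNorm n m G ≤
        (realBilinNorm n m G + (kc 0 - 1 / √2) * complexBilinNorm n m G) / kc 0 := by
      refine csSup_le ⟨_, 0, 0, by simp, by simp, rfl⟩ ?_
      rintro r ⟨a, b, ha, hb, rfl⟩
      rw [le_div_iff₀ kc_zero, mul_comm]
      exact full_bound G a b ha hb
    rw [le_div_iff₀ kc_zero] at h
    have h2 : 1 / √2 * complexBilinNorm n m G ≤ realBilinNorm n m G := by linarith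
    have h3 : 0 < √2 := by positivity
    calc complexBilinNorm n m G = √2 * (1 / √2 * complexBilinNorm n m G) := by field_simp
      _ ≤ _ := mul_le_mul_of_nonneg_left h2 h3.le
end

section
/- (Grothendieck's inequality, real case.) There exists a universal constant K > 0 such that for all integers n, m ≥ 1 and every real matrix C ∈ ℝ^{n×m}: for every integer d ≥ 1 and all unit vectors a_1,…,a_n, b_1,…,b_m in ℝ^d, |Σ_{x,y} C_{xy} ⟨a_x, b_y⟩| ≤ K · sup_{s∈[-1,1]ⁿ, t∈[-1,1]ᵐ} |Σ_{x,y} C_{xy} s_x t_y|. -/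
theorem groth_rad (d : ℕ) : ∃ (Ω : Type) (_ : Fintype Ω) (_ : Nonempty Ω) (e : Fin d → Ω → ℝ),
    (∀ a b : Fin d → ℝ, ∑ w, (∑ i, a i * e i w) * (∑ i, b i * e i w)
      = (Fintype.card Ω : ℝ) * ∑ i, a i * b i) ∧
    (∀ a : Fin d → ℝ, ∑ w, (∑ i, a i * e i w) ^ 4
      ≤ (Fintype.card Ω : ℝ) * (3 * (∑ i, a i ^ 2) ^ 2)) := by
  induction d with
  | zero => exact ⟨Unit, inferInstance, inferInstance, fun _ _ => 0, by simp, by simp⟩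
  | succ d ih =>
    obtain ⟨Ω, hF, hN, e, h2, h4⟩ := ih
    refine ⟨Ω × Bool, inferInstance, inferInstance,
      Fin.cons (fun w => if w.2 then 1 else -1) (fun i w => e i w.1), ?_, ?_⟩
    · intro a b
      have := h2 (fun i => a i.succ) (fun i => b i.succ)
      simp only [Fintype.sum_prod_type, Fin.sum_univ_succ, Fin.cons_zero, Fin.cons_succ,
        Fintype.sum_bool, Fintype.card_prod, Fintype.card_bool, if_true, Bool.false_eq_true,
        if_false]
      push_cast
      calc _ = ∑ w, (2 * (a 0 * b 0) + 2 * ((∑ i : Fin d, a i.succ * e i w) *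
              (∑ i : Fin d, b i.succ * e i w))) := by
            apply Finset.sum_congr rfl; intro w _; ring
        _ = _ := by
            rw [Finset.sum_add_distrib, ← Finset.mul_sum Finset.univ _ (2:ℝ), ← Finset.mul_sum Finset.univ _ (2:ℝ), this]
            simp; ring
    · intro a
      have hh2 := h2 (fun i => a i.succ) (fun i => a i.succ)
      have hh4 := h4 (fun i => a i.succ)
      simp only [Fintype.sum_prod_type, Fin.sum_univ_succ, Fin.cons_zero, Fin.cons_succ,
        Fintype.sum_bool, Fintype.card_prod, Fintype.card_bool, if_true, Bool.false_eq_true,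
        if_false]
      push_cast
      have hsq : ∑ i : Fin d, a i.succ * a i.succ = ∑ i : Fin d, a i.succ ^ 2 :=
        Finset.sum_congr rfl (fun i _ => (sq _).symm)
      rw [hsq] at hh2
      set s := ∑ i : Fin d, a i.succ ^ 2
      have hc : (0:ℝ) ≤ Fintype.card Ω := by positivity
      calc _ = ∑ w, (2 * (a 0) ^ 4 + 12 * (a 0) ^ 2 * ((∑ i : Fin d, a i.succ * e i w) *
              (∑ i : Fin d, a i.succ * e i w)) + 2 * (∑ i : Fin d, a i.succ * e i w) ^ 4) := by
            apply Finset.sum_congr rfl; intro w _; ring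
        _ = (Fintype.card Ω : ℝ) * (2 * (a 0) ^ 4) + 12 * (a 0) ^ 2 * ((Fintype.card Ω : ℝ) * s)
            + 2 * ∑ w, (∑ i : Fin d, a i.succ * e i w) ^ 4 := by
            rw [Finset.sum_add_distrib, Finset.sum_add_distrib, ← Finset.mul_sum,
              ← Finset.mul_sum, ← Finset.mul_sum, hh2]
            simp; ring
        _ ≤ _ := by
            nlinarith [mul_nonneg hc (by positivity : (0:ℝ) ≤ a 0 ^ 4)]

/-- truncation at level two -/
noncomputable def grT (x : ℝ) : ℝ := max (-2) (min 2 x)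

theorem grT_le (x : ℝ) : |grT x| ≤ 2 := by
  unfold grT
  rw [abs_le]
  exact ⟨le_max_left _ _, max_le (by norm_num) (min_le_left _ _)⟩

theorem grT_sq (x : ℝ) : grT x ^ 2 ≤ x ^ 2 := by
  unfold grT
  rcases le_total 2 x with h | h
  · rw [min_eq_left h, max_eq_right (by norm_num)]; nlinarith
  · rw [min_eq_right h]
    rcases le_total (-2) x with h' | h'
    · rw [max_eq_right h']
    · rw [max_eq_left h']; nlinarith

theorem grT_res (x : ℝ) : (x - grT x) ^ 2 ≤ x ^ 4 / 64 := by
  have key : |x - grT x| ≤ x ^ 2 / 8 := by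
    unfold grT
    rcases le_total 2 x with h | h
    · rw [min_eq_left h, max_eq_right (by norm_num), abs_of_nonneg (by linarith)]
      nlinarith [sq_nonneg (x - 4)]
    · rw [min_eq_right h]
      rcases le_total (-2) x with h' | h'
      · rw [max_eq_right h']; simp; positivity
      · rw [max_eq_left h', abs_of_nonpos (by linarith)]
        nlinarith [sq_nonneg (x + 4)]
  have := pow_le_pow_left₀ (abs_nonneg _) key 2
  rw [sq_abs] at this
  linarith [this, (by ring : (x ^ 2 / 8) ^ 2 = x ^ 4 / 64)]

/-- the bound, at all finite index types -/
def grP {n m : ℕ} (C : Matrix (Fin n) (Fin m) ℝ) (B : ℝ) : Prop :=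
  ∀ (ι : Type) [Fintype ι] (a : Fin n → ι → ℝ) (b : Fin m → ι → ℝ) (p q : ℝ), 0 < p → 0 < q →
    (∀ x, ∑ i, a x i ^ 2 ≤ p ^ 2) → (∀ y, ∑ i, b y i ^ 2 ≤ q ^ 2) →
    |∑ x, ∑ y, C x y * ∑ i, a x i * b y i| ≤ p * q * B

theorem gr_triv {n m : ℕ} (C : Matrix (Fin n) (Fin m) ℝ) : grP C (∑ x, ∑ y, |C x y|) := by
  intro ι _ a b p q hp hq ha hb
  rw [Finset.mul_sum]
  refine (Finset.abs_sum_le_sum_abs _ _).trans (Finset.sum_le_sum fun x _ => ?_)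
  rw [Finset.mul_sum]
  refine (Finset.abs_sum_le_sum_abs _ _).trans (Finset.sum_le_sum fun y _ => ?_)
  rw [abs_mul, mul_comm]
  refine mul_le_mul_of_nonneg_right ?_ (abs_nonneg _)
  apply abs_le_of_sq_le_sq _ (by positivity)
  calc _ ≤ (∑ i, a x i ^ 2) * (∑ i, b y i ^ 2) := Finset.sum_mul_sq_le_sq_mul_sq _ _ _
    _ ≤ p ^ 2 * q ^ 2 := mul_le_mul (ha x) (hb y) (by positivity) (by positivity)
    _ = _ := by ring

theorem gr_unit {n m : ℕ} (C : Matrix (Fin n) (Fin m) ℝ) (E B : ℝ) (hB : grP C B)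
    (hE : ∀ (s : Fin n → ℝ) (t : Fin m → ℝ), (∀ x, |s x| ≤ 2) → (∀ y, |t y| ≤ 2) →
      |∑ x, ∑ y, C x y * (s x * t y)| ≤ 4 * E)
    (d : ℕ) (a : Fin n → Fin d → ℝ) (b : Fin m → Fin d → ℝ)
    (ha : ∀ x, ∑ i, a x i ^ 2 ≤ 1) (hb : ∀ y, ∑ i, b y i ^ 2 ≤ 1) :
    |∑ x, ∑ y, C x y * ∑ i, a x i * b y i| ≤ 4 * E + B / 2 := by
  obtain ⟨Ω, hF, hN, e, h2, h4⟩ := groth_rad d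
  have hNpos : (0:ℝ) < Fintype.card Ω := by exact_mod_cast Fintype.card_pos
  set N : ℝ := (Fintype.card Ω : ℝ) with hNdef
  let X : (Fin d → ℝ) → Ω → ℝ := fun u w => ∑ i, u i * e i w
  have hX2 : ∀ u : Fin d → ℝ, ∑ i, u i ^ 2 ≤ 1 → ∑ w, X u w ^ 2 ≤ √N ^ 2 := by
    intro u hu
    rw [Real.sq_sqrt hNpos.le]
    have := h2 u u
    simp only [← sq] at this
    calc _ = _ := this
      _ ≤ N := by nlinarith
  have hT2 : ∀ u : Fin d → ℝ, ∑ i, u i ^ 2 ≤ 1 → ∑ w, grT (X u w) ^ 2 ≤ √N ^ 2 :=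
    fun u hu => (Finset.sum_le_sum fun w _ => grT_sq _).trans (hX2 u hu)
  have hY2 : ∀ u : Fin d → ℝ, ∑ i, u i ^ 2 ≤ 1 →
      ∑ w, (X u w - grT (X u w)) ^ 2 ≤ (√N / 4) ^ 2 := by
    intro u hu
    rw [div_pow, Real.sq_sqrt hNpos.le]
    have h0 : 0 ≤ ∑ i, u i ^ 2 := by positivity
    have h1 : (∑ i, u i ^ 2) ^ 2 ≤ 1 := pow_le_one₀ h0 hu
    calc _ ≤ ∑ w, X u w ^ 4 / 64 := Finset.sum_le_sum fun w _ => grT_res _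
      _ = (∑ w, X u w ^ 4) / 64 := by rw [Finset.sum_div]
      _ ≤ (N * (3 * (∑ i, u i ^ 2) ^ 2)) / 64 := by
        have := h4 u
        gcongr
      _ ≤ _ := by nlinarith
  have hs : 0 < √N := Real.sqrt_pos.2 hNpos
  have b1 := hB Ω (fun x w => grT (X (a x) w)) (fun y w => X (b y) w - grT (X (b y) w))
    (√N) (√N / 4) hs (by positivity) (fun x => hT2 _ (ha x)) (fun y => hY2 _ (hb y))
  have b2 := hB Ω (fun x w => X (a x) w - grT (X (a x) w)) (fun y w => X (b y) w)
    (√N / 4) (√N) (by positivity) hs (fun x => hY2 _ (ha x)) (fun y => hX2 _ (hb y))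
  have b0 : |∑ x, ∑ y, C x y * ∑ w, grT (X (a x) w) * grT (X (b y) w)| ≤ N * (4 * E) := by
    have : ∑ x, ∑ y, C x y * ∑ w, grT (X (a x) w) * grT (X (b y) w)
        = ∑ w, ∑ x, ∑ y, C x y * (grT (X (a x) w) * grT (X (b y) w)) := by
      symm
      rw [Finset.sum_comm]
      refine Finset.sum_congr rfl fun x _ => ?_
      rw [Finset.sum_comm]
      refine Finset.sum_congr rfl fun y _ => ?_
      rw [Finset.mul_sum]
    rw [this]
    refine (Finset.abs_sum_le_sum_abs _ _).trans ?_
    refine (Finset.sum_le_sum fun w _ => hE (fun x => grT (X (a x) w)) (fun y => grT (X (b y) w))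
      (fun x => grT_le _) (fun y => grT_le _)).trans ?_
    simp [hNdef]
  have split : N * ∑ x, ∑ y, C x y * ∑ i, a x i * b y i
      = ∑ x, ∑ y, C x y * ∑ w, grT (X (a x) w) * grT (X (b y) w)
      + ∑ x, ∑ y, C x y * ∑ w, grT (X (a x) w) * (X (b y) w - grT (X (b y) w))
      + ∑ x, ∑ y, C x y * ∑ w, (X (a x) w - grT (X (a x) w)) * X (b y) w := by
    simp only [Finset.mul_sum (s := (Finset.univ : Finset (Fin n))),
      Finset.mul_sum (s := (Finset.univ : Finset (Fin m))), ← Finset.sum_add_distrib]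
    refine Finset.sum_congr rfl fun x _ => Finset.sum_congr rfl fun y _ => ?_
    rw [mul_left_comm, ← h2, ← mul_add, ← mul_add, ← Finset.sum_add_distrib,
      ← Finset.sum_add_distrib]
    congr 1
    refine Finset.sum_congr rfl fun w _ => ?_
    simp only [X]
    ring
  have hss : √N * √N = N := Real.mul_self_sqrt hNpos.le
  have fin : N * |∑ x, ∑ y, C x y * ∑ i, a x i * b y i| ≤ N * (4 * E + B / 2) := by
    rw [← abs_of_pos hNpos, ← abs_mul, abs_of_pos hNpos, split]
    refine (abs_add_three _ _ _).trans ((add_le_add (add_le_add b0 b1) b2).trans (le_of_eq ?_))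
    linear_combination (B / 2) * hss
  exact le_of_mul_le_mul_left fin hNpos

theorem gr_step {n m : ℕ} (C : Matrix (Fin n) (Fin m) ℝ) (E B : ℝ) (hB : grP C B)
    (hE : ∀ (s : Fin n → ℝ) (t : Fin m → ℝ), (∀ x, |s x| ≤ 2) → (∀ y, |t y| ≤ 2) →
      |∑ x, ∑ y, C x y * (s x * t y)| ≤ 4 * E) : grP C (4 * E + B / 2) := by
  intro ι _ a b p q hp hq ha hb
  let f := Fintype.equivFin ι
  have aux : ∀ (u : ι → ℝ) (r : ℝ), 0 < r → ∑ i, u i ^ 2 ≤ r ^ 2 →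
      ∑ j, (u (f.symm j) / r) ^ 2 ≤ 1 := by
    intro u r hr hu
    rw [f.symm.sum_comp (fun i => (u i / r) ^ 2)]
    simp only [div_pow]
    rw [← Finset.sum_div]
    exact (div_le_one (by positivity)).2 hu
  have := gr_unit C E B hB hE _ (fun x j => a x (f.symm j) / p) (fun y j => b y (f.symm j) / q)
    (fun x => aux _ _ hp (ha x)) (fun y => aux _ _ hq (hb y))
  have e1 : ∑ x, ∑ y, C x y * ∑ i, a x i * b y i = p * q * ∑ x, ∑ y, C x y *
      ∑ j, a x (f.symm j) / p * (b y (f.symm j) / q) := by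
    simp only [Finset.mul_sum (s := (Finset.univ : Finset (Fin n))),
      Finset.mul_sum (s := (Finset.univ : Finset (Fin m)))]
    refine Finset.sum_congr rfl fun x _ => Finset.sum_congr rfl fun y _ => ?_
    rw [f.symm.sum_comp (fun i => a x i / p * (b y i / q)), mul_left_comm,
      Finset.mul_sum _ _ (p * q)]
    congr 1
    refine Finset.sum_congr rfl fun i _ => ?_
    field_simp
  rw [e1, abs_mul, abs_of_pos (mul_pos hp hq)]
  exact mul_le_mul_of_nonneg_left this (mul_pos hp hq).le

theorem gr_iter {n m : ℕ} (C : Matrix (Fin n) (Fin m) ℝ) (E B : ℝ) (hB : grP C B)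
    (hE : ∀ (s : Fin n → ℝ) (t : Fin m → ℝ), (∀ x, |s x| ≤ 2) → (∀ y, |t y| ≤ 2) →
      |∑ x, ∑ y, C x y * (s x * t y)| ≤ 4 * E) (k : ℕ) :
    grP C (8 * E + (B - 8 * E) * (1 / 2) ^ k) := by
  induction k with
  | zero => simpa using hB
  | succ k ih =>
    have := gr_step C E _ ih hE
    convert this using 1
    ring


/-- Grothendieck's inequality, real case: there is a universal constant
`K > 0` such that for every real matrix `C`, every dimension `d ≥ 1` and all unit
vectors `a_x, b_y ∈ ℝ^d`,
`|Σ_{x,y} C_{xy} ⟨a_x,b_y⟩| ≤ K · sup_{s,t ∈ [-1,1]} |Σ_{x,y} C_{xy} s_x t_y|`. -/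
theorem stmt2 :
    ∃ K : ℝ, 0 < K ∧
      ∀ (n m : ℕ), 1 ≤ n → 1 ≤ m → ∀ (C : Matrix (Fin n) (Fin m) ℝ),
        ∀ (d : ℕ), 1 ≤ d →
          ∀ (a : Fin n → Fin d → ℝ) (b : Fin m → Fin d → ℝ),
            (∀ x, ∑ i, a x i ^ 2 = 1) → (∀ y, ∑ i, b y i ^ 2 = 1) →
            |∑ x, ∑ y, C x y * ∑ i, a x i * b y i| ≤
              K * sSup {r : ℝ | ∃ (s : Fin n → ℝ) (t : Fin m → ℝ),
                (∀ x, |s x| ≤ 1) ∧ (∀ y, |t y| ≤ 1) ∧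
                r = |∑ x, ∑ y, C x y * s x * t y|} := by
  refine ⟨8, by norm_num, ?_⟩
  intro n m _ _ C d _ a b ha hb
  set S : Set ℝ := {r : ℝ | ∃ (s : Fin n → ℝ) (t : Fin m → ℝ),
                (∀ x, |s x| ≤ 1) ∧ (∀ y, |t y| ≤ 1) ∧
                r = |∑ x, ∑ y, C x y * s x * t y|} with hS
  have hbdd : BddAbove S := by
    refine ⟨∑ x, ∑ y, |C x y|, ?_⟩
    rintro r ⟨s, t, hs, ht, rfl⟩
    refine (Finset.abs_sum_le_sum_abs _ _).trans (Finset.sum_le_sum fun x _ => ?_)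
    refine (Finset.abs_sum_le_sum_abs _ _).trans (Finset.sum_le_sum fun y _ => ?_)
    rw [mul_assoc, abs_mul, abs_mul]
    exact mul_le_of_le_one_right (abs_nonneg _) (mul_le_one₀ (hs x) (abs_nonneg _) (ht y))
  have hE : ∀ (s : Fin n → ℝ) (t : Fin m → ℝ), (∀ x, |s x| ≤ 2) → (∀ y, |t y| ≤ 2) →
      |∑ x, ∑ y, C x y * (s x * t y)| ≤ 4 * sSup S := by
    intro s t hs ht
    have hmem : |∑ x, ∑ y, C x y * (s x / 2) * (t y / 2)| ≤ sSup S := by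
      refine le_csSup hbdd ⟨fun x => s x / 2, fun y => t y / 2, fun x => ?_, fun y => ?_, rfl⟩
      · rw [abs_div, abs_two]; linarith [hs x]
      · rw [abs_div, abs_two]; linarith [ht y]
    have e1 : ∑ x, ∑ y, C x y * (s x * t y)
        = 4 * ∑ x, ∑ y, C x y * (s x / 2) * (t y / 2) := by
      simp only [Finset.mul_sum]
      refine Finset.sum_congr rfl fun x _ => Finset.sum_congr rfl fun y _ => ?_
      ring
    rw [e1, abs_mul, abs_of_pos (by norm_num : (0:ℝ) < 4)]
    linarith
  have hk : ∀ k : ℕ, |∑ x, ∑ y, C x y * ∑ i, a x i * b y i|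
      ≤ 8 * sSup S + (∑ x, ∑ y, |C x y| - 8 * sSup S) * (1 / 2) ^ k := by
    intro k
    have := gr_iter C _ _ (gr_triv C) hE k (Fin d) a b 1 1 one_pos one_pos
      (fun x => by rw [ha x]; norm_num) (fun y => by rw [hb y]; norm_num)
    simpa using this
  have hlim : Filter.Tendsto (fun k : ℕ => 8 * sSup S +
      (∑ x, ∑ y, |C x y| - 8 * sSup S) * (1 / 2 : ℝ) ^ k) Filter.atTop
      (nhds (8 * sSup S + (∑ x, ∑ y, |C x y| - 8 * sSup S) * 0)) :=
    ((tendsto_pow_atTop_nhds_zero_of_lt_one (by norm_num) (by norm_num)).const_mul _).const_add _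
  rw [mul_zero, add_zero] at hlim
  exact ge_of_tendsto' hlim hk
end

section
/- (Tsirelson.) For all integers n, m, D ≥ 1 and all unit vectors a_1,…,a_n, b_1,…,b_m ∈ ℝ^D, there exist an integer d ≥ 1, Hermitian matrices A_1,…,A_n, B_1,…,B_m ∈ M_d(ℂ) satisfying A_x² = I and B_y² = I for all x, y, and a unit vector ψ ∈ ℂ^d ⊗ ℂ^d, such that ⟨ψ, (A_x ⊗ B_y) ψ⟩ = ⟨a_x, b_y⟩ for every x ∈ {1,…,n} and y ∈ {1,…,m}. -/
theorem cliff_exists (D : ℕ) : ∃ (ι : Type) (_ : Fintype ι) (_ : DecidableEq ι) (_ : Nonempty ι)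
    (G : Fin D → Matrix ι ι ℂ), (∀ i, (G i).IsHermitian) ∧
      ∀ i j, G i * G j + G j * G i = if i = j then (2 : ℂ) • (1 : Matrix ι ι ℂ) else 0 := by
  induction D with
  | zero => exact ⟨Unit, inferInstance, inferInstance, inferInstance, fun i => i.elim0,
      fun i => i.elim0, fun i => i.elim0⟩
  | succ D ih =>
    obtain ⟨ι, _, _, _, G, hG, hc⟩ := ih
    refine ⟨ι ⊕ ι, inferInstance, inferInstance, inferInstance,
      Fin.cons (Matrix.fromBlocks 0 1 1 0) (fun i => Matrix.fromBlocks (G i) 0 0 (-G i)), ?_, ?_⟩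
    · intro i
      refine Fin.cases ?_ (fun i => ?_) i
      · simp [Matrix.IsHermitian, Matrix.fromBlocks_conjTranspose]
      · have := hG i
        simp only [Matrix.IsHermitian] at this
        simp [Matrix.IsHermitian, Matrix.fromBlocks_conjTranspose, this]
    · intro i j
      refine Fin.cases ?_ (fun i => ?_) i <;> refine Fin.cases ?_ (fun j => ?_) j
      · simp [Matrix.fromBlocks_multiply, Matrix.fromBlocks_add, two_smul]
      · simp [Matrix.fromBlocks_multiply, Matrix.fromBlocks_add, (Fin.succ_ne_zero j).symm]
      · simp [Matrix.fromBlocks_multiply, Matrix.fromBlocks_add]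
      · have := hc i j
        simp only [Fin.cons_succ, Matrix.fromBlocks_multiply, Matrix.fromBlocks_add, Fin.succ_inj]
        simp only [Matrix.mul_zero, Matrix.zero_mul, add_zero, zero_add, neg_mul_neg, this]
        split_ifs
        · rw [← Matrix.fromBlocks_one, Matrix.fromBlocks_smul]; simp
        · simp

theorem cliff_fin (D : ℕ) : ∃ d : ℕ, 1 ≤ d ∧ ∃ S : (Fin D → ℝ) → Matrix (Fin d) (Fin d) ℂ,
    (∀ v, (S v).IsHermitian) ∧
      ∀ v w, S v * S w + S w * S v = (2 * ((∑ i, v i * w i : ℝ) : ℂ)) • 1 := by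
  obtain ⟨ι, _, _, _, G, hG, hc⟩ := cliff_exists D
  let e := Fintype.equivFin ι
  have key : ∀ v w : Fin D → ℝ, (∑ i, (v i : ℂ) • G i) * (∑ i, (w i : ℂ) • G i) +
      (∑ i, (w i : ℂ) • G i) * (∑ i, (v i : ℂ) • G i) =
      (2 * ((∑ i, v i * w i : ℝ) : ℂ)) • (1 : Matrix ι ι ℂ) := by
    intro v w
    rw [Finset.sum_mul_sum, Finset.sum_mul_sum, Finset.sum_comm (s := Finset.univ)
      (f := fun i j => ((w i : ℂ) • G i) * ((v j : ℂ) • G j)), ← Finset.sum_add_distrib]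
    have : ∀ i j, ((v i : ℂ) • G i) * ((w j : ℂ) • G j) + ((w j : ℂ) • G j) * ((v i : ℂ) • G i)
        = if i = j then ((v i : ℂ) * w j * 2) • (1 : Matrix ι ι ℂ) else 0 := by
      intro i j
      have h := hc i j
      rw [smul_mul_smul_comm, smul_mul_smul_comm, mul_comm (w j : ℂ), ← smul_add, h]
      split_ifs <;> simp [smul_smul]
    simp only [← Finset.sum_add_distrib, this]
    simp only [Finset.sum_ite_eq, Finset.mem_univ, if_true, ← Finset.sum_smul, ← Finset.sum_mul]
    push_cast
    rw [mul_comm]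
  refine ⟨Fintype.card ι, Fintype.card_pos, fun v => (∑ i, (v i : ℂ) • G i).submatrix e.symm e.symm,
    ?_, ?_⟩
  · intro v
    apply Matrix.IsHermitian.submatrix
    unfold Matrix.IsHermitian
    rw [Matrix.conjTranspose_sum]
    refine Finset.sum_congr rfl fun i _ => ?_
    rw [Matrix.conjTranspose_smul, (hG i).eq]
    simp
  · intro v w
    rw [Matrix.submatrix_mul_equiv, Matrix.submatrix_mul_equiv]
    ext i j
    have h := congrFun (congrFun (key v w) (e.symm i)) (e.symm j)
    rw [Matrix.add_apply] at h
    rw [Matrix.add_apply, Matrix.submatrix_apply, Matrix.submatrix_apply, h]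
    simp [Matrix.one_apply]


/-- Tsirelson: any family of real unit vectors can be realized as
correlations `⟨ψ|A_x ⊗ B_y|ψ⟩` of ±1-observables on a finite-dimensional bipartite
quantum state. -/
theorem stmt3 (n m D : ℕ) (hn : 1 ≤ n) (hm : 1 ≤ m) (hD : 1 ≤ D)
    (a : Fin n → Fin D → ℝ) (b : Fin m → Fin D → ℝ)
    (ha : ∀ x, ∑ i, a x i ^ 2 = 1) (hb : ∀ y, ∑ i, b y i ^ 2 = 1) :
    ∃ (d : ℕ), 1 ≤ d ∧
      ∃ (A : Fin n → Matrix (Fin d) (Fin d) ℂ) (B : Fin m → Matrix (Fin d) (Fin d) ℂ)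
        (ψ : Fin d × Fin d → ℂ),
        (∀ x, (A x).IsHermitian ∧ A x * A x = 1) ∧
        (∀ y, (B y).IsHermitian ∧ B y * B y = 1) ∧
        (∑ p, ‖ψ p‖ ^ 2 = 1) ∧
        ∀ x y,
          (∑ p : Fin d × Fin d, ∑ q : Fin d × Fin d,
              (starRingEnd ℂ) (ψ p) * (A x p.1 q.1 * B y p.2 q.2) * ψ q)
            = ((∑ i, a x i * b y i : ℝ) : ℂ) := by
  obtain ⟨d, hd, S, hS, hc⟩ := cliff_fin D
  have hd0 : (d : ℝ) ≠ 0 := by positivity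
  have hdc : (d : ℂ) ≠ 0 := by exact_mod_cast hd0
  have hsq : ∀ v : Fin D → ℝ, ∑ i, v i ^ 2 = 1 → S v * S v = 1 := by
    intro v hv
    have h := hc v v
    simp only [← pow_two (v _)] at h
    rw [hv, ← two_smul ℂ (S v * S v)] at h
    simp only [Complex.ofReal_one, mul_one] at h
    exact smul_right_injective _ (two_ne_zero' ℂ) h
  have hns : ((√(d : ℝ))⁻¹) ^ 2 = (d : ℝ)⁻¹ := by
    rw [inv_pow, Real.sq_sqrt (by positivity)]
  refine ⟨d, hd, fun x => S (a x), fun y => (S (b y)).transpose,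
    fun p => if p.1 = p.2 then (((√(d : ℝ))⁻¹ : ℝ) : ℂ) else 0,
    fun x => ⟨hS _, hsq _ (ha x)⟩, fun y => ⟨(hS _).transpose, ?_⟩, ?_, ?_⟩
  · rw [← Matrix.transpose_mul, hsq _ (hb y), Matrix.transpose_one]
  · have : ∀ p : Fin d × Fin d, ‖(if p.1 = p.2 then (((√(d : ℝ))⁻¹ : ℝ) : ℂ) else 0)‖ ^ 2
        = if p.1 = p.2 then (d : ℝ)⁻¹ else 0 := by
      intro p
      split_ifs
      · rw [Complex.norm_real, Real.norm_eq_abs, sq_abs, hns]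
      · simp
    simp only [this, Fintype.sum_prod_type]
    simp [hd0]
  · intro x y
    have htr : (S (a x) * S (b y)).trace = d * ((∑ i, a x i * b y i : ℝ) : ℂ) := by
      have h := congrArg Matrix.trace (hc (a x) (b y))
      rw [Matrix.trace_add, Matrix.trace_mul_comm (S (b y)), Matrix.trace_smul,
        Matrix.trace_one, Fintype.card_fin, smul_eq_mul] at h
      linear_combination h / 2
    have hns' : (((√(d : ℝ))⁻¹ : ℝ) : ℂ) * (((√(d : ℝ))⁻¹ : ℝ) : ℂ) = (d : ℂ)⁻¹ := by
      rw [← Complex.ofReal_mul, ← pow_two, hns]; simp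
    have : ∀ c : ℝ, (∑ p : Fin d × Fin d, ∑ q : Fin d × Fin d,
        (starRingEnd ℂ) (if p.1 = p.2 then (c : ℂ) else 0) *
          (S (a x) p.1 q.1 * (S (b y)).transpose p.2 q.2) * (if q.1 = q.2 then (c : ℂ) else 0))
        = (c * c : ℂ) * (S (a x) * S (b y)).trace := by
      intro c
      simp only [Fintype.sum_prod_type, Matrix.trace, Matrix.diag, Matrix.mul_apply,
        Matrix.transpose_apply, apply_ite (starRingEnd ℂ), map_zero, Complex.conj_ofReal,
        mul_ite, mul_zero, ite_mul, zero_mul, Finset.sum_ite_eq, Finset.mem_univ, if_true,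
        Finset.mul_sum]
      refine Finset.sum_congr rfl fun i _ => ?_
      rw [Finset.sum_eq_single i]
      · refine Finset.sum_congr rfl fun j _ => ?_
        simp
        ring
      · intro j _ hj
        simp [hj.symm]
      · simp
    rw [this, htr, hns', ← mul_assoc, inv_mul_cancel₀ hdc, one_mul]
end

section
/- (Tsirelson's bound via Grothendieck's inequality.) Let K > 0 be any constant satisfying the real Grothendieck inequality, i.e., for every real matrix C, every d ≥ 1 and all unit vectors a_x, b_y ∈ ℝ^d, |Σ_{x,y} C_{xy} ⟨a_x, b_y⟩| ≤ K sup_{s∈[-1,1], t∈[-1,1]} |Σ_{x,y} C_{xy} s_x t_y|. Then for every XOR game tensor G ∈ ℝ^{n×m}, the entangled bias satisfies β*(G) ≤ K · β(G). -/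
/-- A matrix has operator norm (on `ℓ₂`) at most one. -/
def IsContraction {d : ℕ} (A : Matrix (Fin d) (Fin d) ℂ) : Prop :=
  ∀ v : Fin d → ℂ,
    ∑ i, ‖A.mulVec v i‖ ^ 2 ≤ ∑ i, ‖v i‖ ^ 2

/-- The classical bias of the two-player XOR game with tensor `G`. -/
noncomputable def xorCBias {n m : ℕ} (G : Matrix (Fin n) (Fin m) ℝ) : ℝ :=
  sSup {r : ℝ | ∃ (a : Fin n → ℝ) (b : Fin m → ℝ),
    (∀ x, |a x| ≤ 1) ∧ (∀ y, |b y| ≤ 1) ∧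
    r = |∑ x, ∑ y, G x y * a x * b y|}

/-- The entangled bias of the two-player XOR game with tensor `G`: supremum over all
dimensions `d ≥ 1`, unit vectors `ψ ∈ ℂ^d ⊗ ℂ^d` and matrices of operator norm at
most one. -/
noncomputable def xorQBias {n m : ℕ} (G : Matrix (Fin n) (Fin m) ℝ) : ℝ :=
  sSup {r : ℝ | ∃ (d : ℕ) (ψ : Fin d × Fin d → ℂ)
      (A : Fin n → Matrix (Fin d) (Fin d) ℂ) (B : Fin m → Matrix (Fin d) (Fin d) ℂ),
    1 ≤ d ∧ (∑ p, ‖ψ p‖ ^ 2 = 1) ∧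
    (∀ x, IsContraction (A x)) ∧ (∀ y, IsContraction (B y)) ∧
    r = ‖∑ x, ∑ y, (G x y : ℂ) *
          ∑ p : Fin d × Fin d, ∑ q : Fin d × Fin d,
            (starRingEnd ℂ) (ψ p) * (A x p.1 q.1 * B y p.2 q.2) * ψ q‖}

lemma groth_fintype (K : ℝ)
    (hGroth : ∀ (n m : ℕ) (C : Matrix (Fin n) (Fin m) ℝ),
      ∀ (d : ℕ), 1 ≤ d →
        ∀ (a : Fin n → Fin d → ℝ) (b : Fin m → Fin d → ℝ),
          (∀ x, ∑ i, a x i ^ 2 = 1) → (∀ y, ∑ i, b y i ^ 2 = 1) →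
          |∑ x, ∑ y, C x y * ∑ i, a x i * b y i| ≤
            K * sSup {r : ℝ | ∃ (s : Fin n → ℝ) (t : Fin m → ℝ),
              (∀ x, |s x| ≤ 1) ∧ (∀ y, |t y| ≤ 1) ∧
              r = |∑ x, ∑ y, C x y * s x * t y|})
    {n m : ℕ} (G : Matrix (Fin n) (Fin m) ℝ) {ι : Type} [Fintype ι]
    (a : Fin n → ι → ℝ) (b : Fin m → ι → ℝ)
    (ha : ∀ x, ∑ i, a x i ^ 2 ≤ 1) (hb : ∀ y, ∑ i, b y i ^ 2 ≤ 1) :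
    |∑ x, ∑ y, G x y * ∑ i, a x i * b y i| ≤ K * xorCBias G := by
  let e := Fintype.equivFin (ι ⊕ Bool)
  let a' : Fin n → ι ⊕ Bool → ℝ := fun x =>
    Sum.elim (a x) (fun c => if c then √(1 - ∑ i, a x i ^ 2) else 0)
  let b' : Fin m → ι ⊕ Bool → ℝ := fun y =>
    Sum.elim (b y) (fun c => if c then 0 else √(1 - ∑ i, b y i ^ 2))
  have key := hGroth n m G (Fintype.card (ι ⊕ Bool))
    (by rw [Fintype.card_sum]; simp)
    (fun x i => a' x (e.symm i)) (fun y i => b' y (e.symm i)) ?_ ?_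
  · have h : ∀ x y, ∑ i, a' x (e.symm i) * b' y (e.symm i) = ∑ i, a x i * b y i := by
      intro x y
      rw [Equiv.sum_comp e.symm (fun i => a' x i * b' y i), Fintype.sum_sum_type]
      simp [a', b']
    simp only [h] at key
    exact key
  · intro x
    rw [Equiv.sum_comp e.symm (fun i => a' x i ^ 2), Fintype.sum_sum_type]
    simp [a', Real.sq_sqrt (sub_nonneg.2 (ha x))]
  · intro y
    rw [Equiv.sum_comp e.symm (fun i => b' y i ^ 2), Fintype.sum_sum_type]
    simp [b', Real.sq_sqrt (sub_nonneg.2 (hb y))]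

lemma contraction_transpose {d : ℕ} {A : Matrix (Fin d) (Fin d) ℂ} (hA : IsContraction A)
    (v : Fin d → ℂ) :
    ∑ i, ‖∑ j, v j * A j i‖ ^ 2 ≤ ∑ i, ‖v i‖ ^ 2 := by
  set w : Fin d → ℂ := fun i => ∑ j, v j * A j i with hw
  let cw : Fin d → ℂ := fun i => (starRingEnd ℂ) (w i)
  have h1 : ((∑ i, ‖w i‖ ^ 2 : ℝ) : ℂ) = ∑ j, v j * A.mulVec cw j := by
    push_cast
    have : ∀ i, ((‖w i‖ : ℂ)) ^ 2 = ∑ j, v j * A j i * cw i := by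
      intro i
      rw [← Complex.mul_conj', ← Finset.sum_mul]
    simp only [this, Matrix.mulVec, dotProduct, Finset.mul_sum]
    rw [Finset.sum_comm]
    simp only [mul_assoc]
  have h2 : (∑ i, ‖w i‖ ^ 2 : ℝ) ≤ ∑ j, ‖v j‖ * ‖A.mulVec cw j‖ := by
    have h0 : (0 : ℝ) ≤ ∑ i, ‖w i‖ ^ 2 := by positivity
    calc (∑ i, ‖w i‖ ^ 2 : ℝ) = ‖((∑ i, ‖w i‖ ^ 2 : ℝ) : ℂ)‖ := by
          rw [Complex.norm_real, Real.norm_of_nonneg h0]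
      _ ≤ _ := by
          rw [h1]
          refine (norm_sum_le _ _).trans (le_of_eq ?_)
          simp
  have h3 := hA cw
  have h4 : ∑ i, ‖cw i‖ ^ 2 = ∑ i, ‖w i‖ ^ 2 := by simp [cw]
  have h5 : ∑ j, ‖v j‖ * ‖A.mulVec cw j‖ ≤ ∑ j, (‖v j‖ ^ 2 + ‖A.mulVec cw j‖ ^ 2) / 2 := by
    refine Finset.sum_le_sum fun j _ => ?_
    nlinarith [sq_nonneg (‖v j‖ - ‖A.mulVec cw j‖)]
  rw [← Finset.sum_div, Finset.sum_add_distrib] at h5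
  linarith


lemma mul_sum_sum_left {n m : ℕ} (G : Matrix (Fin n) (Fin m) ℝ) (ω : ℂ)
    (S : Fin n → Fin m → ℂ) :
    ω * ∑ x, ∑ y, (G x y : ℂ) * S x y = ∑ x, ∑ y, (G x y : ℂ) * (ω * S x y) := by
  rw [Finset.mul_sum]
  refine Finset.sum_congr rfl fun x _ => ?_
  rw [Finset.mul_sum]
  exact Finset.sum_congr rfl fun y _ => mul_left_comm _ _ _

/-- Tsirelson's bound via Grothendieck's inequality: if `K` satisfies the
real Grothendieck inequality then for every XOR game tensor `G`, `β*(G) ≤ K β(G)`. -/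
theorem stmt4 (K : ℝ) (hK : 0 < K)
    (hGroth : ∀ (n m : ℕ) (C : Matrix (Fin n) (Fin m) ℝ),
      ∀ (d : ℕ), 1 ≤ d →
        ∀ (a : Fin n → Fin d → ℝ) (b : Fin m → Fin d → ℝ),
          (∀ x, ∑ i, a x i ^ 2 = 1) → (∀ y, ∑ i, b y i ^ 2 = 1) →
          |∑ x, ∑ y, C x y * ∑ i, a x i * b y i| ≤
            K * sSup {r : ℝ | ∃ (s : Fin n → ℝ) (t : Fin m → ℝ),
              (∀ x, |s x| ≤ 1) ∧ (∀ y, |t y| ≤ 1) ∧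
              r = |∑ x, ∑ y, C x y * s x * t y|}) :
    ∀ (n m : ℕ) (G : Matrix (Fin n) (Fin m) ℝ),
      xorQBias G ≤ K * xorCBias G := by
  intro n m G
  have hC : 0 ≤ xorCBias G := by
    apply Real.sSup_nonneg
    rintro r ⟨a, b, -, -, rfl⟩
    exact abs_nonneg _
  apply Real.sSup_le _ (mul_nonneg hK.le hC)
  rintro r ⟨d, ψ, A, B, -, hψ, hA, hB, rfl⟩
  obtain ⟨ω, hω, hz⟩ := RCLike.exists_norm_eq_mul_self (∑ x, ∑ y, (G x y : ℂ) *
          ∑ p : Fin d × Fin d, ∑ q : Fin d × Fin d,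
            (starRingEnd ℂ) (ψ p) * (A x p.1 q.1 * B y p.2 q.2) * ψ q)
  let v : Fin n → Fin d × Fin d → ℂ := fun x s =>
    ω * ∑ i, (starRingEnd ℂ) (ψ (i, s.2)) * A x i s.1
  let w : Fin m → Fin d × Fin d → ℂ := fun y s => ∑ j, B y s.2 j * ψ (s.1, j)
  have hv : ∀ x, ∑ s, ‖v x s‖ ^ 2 ≤ 1 := by
    intro x
    rw [← hψ, Fintype.sum_prod_type_right, Fintype.sum_prod_type_right]
    refine Finset.sum_le_sum fun j _ => ?_
    have := contraction_transpose (hA x) (fun i => (starRingEnd ℂ) (ψ (i, j)))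
    simpa [v, hω] using this
  have hw : ∀ y, ∑ s, ‖w y s‖ ^ 2 ≤ 1 := by
    intro y
    rw [← hψ, Fintype.sum_prod_type, Fintype.sum_prod_type]
    refine Finset.sum_le_sum fun i _ => ?_
    exact hB y (fun j => ψ (i, j))
  have hsum : ∀ x y, ω * (∑ p : Fin d × Fin d, ∑ q : Fin d × Fin d,
            (starRingEnd ℂ) (ψ p) * (A x p.1 q.1 * B y p.2 q.2) * ψ q)
      = ∑ s, v x s * w y s := by
    intro x y
    simp only [v, w, mul_assoc, ← Finset.mul_sum]
    congr 1
    simp only [Fintype.sum_prod_type, Finset.mul_sum, Finset.sum_mul]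
    calc _ = ∑ i, ∑ k, ∑ j, ∑ l, (starRingEnd ℂ) (ψ (i, j)) *
              (A x i k * (B y j l * ψ (k, l))) := by
          refine Finset.sum_congr rfl fun i _ => ?_
          rw [Finset.sum_comm]
      _ = ∑ k, ∑ i, ∑ j, ∑ l, (starRingEnd ℂ) (ψ (i, j)) *
              (A x i k * (B y j l * ψ (k, l))) := Finset.sum_comm
      _ = _ := by
          refine Finset.sum_congr rfl fun k _ => ?_
          rw [Finset.sum_comm]
          refine Finset.sum_congr rfl fun j _ => ?_
          rw [Finset.sum_comm]
          simp only [mul_assoc]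
  let a : Fin n → (Fin d × Fin d) ⊕ (Fin d × Fin d) → ℝ := fun x =>
    Sum.elim (fun s => (v x s).re) (fun s => - (v x s).im)
  let b : Fin m → (Fin d × Fin d) ⊕ (Fin d × Fin d) → ℝ := fun y =>
    Sum.elim (fun s => (w y s).re) (fun s => (w y s).im)
  have key := groth_fintype K hGroth G a b ?_ ?_
  · refine le_trans (le_trans (le_of_eq ?_) (le_abs_self _)) key
    have h := congrArg Complex.re hz
    rw [mul_sum_sum_left G ω] at h
    simp only [hsum] at h
    have h' : ∀ x y, ∑ i, a x i * b y i = (∑ s, v x s * w y s).re := by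
      intro x y
      rw [Fintype.sum_sum_type, ← Finset.sum_add_distrib, Complex.re_sum]
      refine Finset.sum_congr rfl fun s _ => ?_
      simp [a, b, Complex.mul_re]
      ring
    simp only [h']
    refine (Eq.trans ?_ h).trans ?_
    · exact (Complex.ofReal_re _).symm
    · simp only [Complex.re_sum, Complex.re_ofReal_mul]
  · intro x
    refine le_trans (le_of_eq ?_) (hv x)
    rw [Fintype.sum_sum_type, ← Finset.sum_add_distrib]
    refine Finset.sum_congr rfl fun s _ => ?_
    simp only [a, Sum.elim_inl, Sum.elim_inr, Complex.sq_norm, Complex.normSq_apply]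
    ring
  · intro y
    refine le_trans (le_of_eq ?_) (hw y)
    rw [Fintype.sum_sum_type, ← Finset.sum_add_distrib]
    refine Finset.sum_congr rfl fun s _ => ?_
    simp only [b, Sum.elim_inl, Sum.elim_inr, Complex.sq_norm, Complex.normSq_apply]
    ring
end

section
/- (Perfect direct sum for the entangled bias of XOR games.) For all real matrices G₁ ∈ ℝ^{n₁×m₁} and G₂ ∈ ℝ^{n₂×m₂}, the quantity ‖·‖_{γ₂*} is multiplicative under the Kronecker product: ‖G₁ ⊗ G₂‖_{γ₂*} = ‖G₁‖_{γ₂*} · ‖G₂‖_{γ₂*}, where G₁ ⊗ G₂ ∈ ℝ^{(n₁n₂)×(m₁m₂)} has entries (G₁⊗G₂)_{(x₁,x₂),(y₁,y₂)} = (G₁)_{x₁y₁}(G₂)_{x₂y₂}. -/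
/-- The `γ₂*` norm of a real matrix `C`: the supremum over all dimensions `d ≥ 1` and
unit vectors `a_x, b_y ∈ ℝ^d` of `|Σ_{x,y} C_{xy} ⟨a_x, b_y⟩|`. -/
noncomputable def gammaTwoStar {X Y : Type*} [Fintype X] [Fintype Y]
    (C : Matrix X Y ℝ) : ℝ :=
  sSup {r : ℝ | ∃ (d : ℕ) (a : X → Fin d → ℝ) (b : Y → Fin d → ℝ),
    1 ≤ d ∧ (∀ x, ∑ i, a x i ^ 2 = 1) ∧ (∀ y, ∑ i, b y i ^ 2 = 1) ∧
    r = |∑ x, ∑ y, C x y * ∑ i, a x i * b y i|}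

open Matrix in
lemma psd_block {X Y : Type*} [Fintype X] [Fintype Y] [DecidableEq X] [DecidableEq Y]
    (C : Matrix X Y ℝ) (l : X → ℝ) (k : Y → ℝ) :
    (Matrix.fromBlocks (Matrix.diagonal l) C Cᵀ (Matrix.diagonal k)).PosSemidef ↔
    ∀ (u : X → ℝ) (v : Y → ℝ),
      0 ≤ ∑ x, l x * u x ^ 2 + ∑ y, k y * v y ^ 2 + 2 * ∑ x, ∑ y, C x y * (u x * v y) := by
  have key : ∀ (u : X → ℝ) (v : Y → ℝ),
      star (Sum.elim u v) ⬝ᵥ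
        ((Matrix.fromBlocks (Matrix.diagonal l) C Cᵀ (Matrix.diagonal k)) *ᵥ (Sum.elim u v)) =
      ∑ x, l x * u x ^ 2 + ∑ y, k y * v y ^ 2 + 2 * ∑ x, ∑ y, C x y * (u x * v y) := by
    intro u v
    have h1 : ∑ x, ∑ y, C x y * (u x * v y) = ∑ x, u x * ∑ y, C x y * v y := by
      refine Finset.sum_congr rfl fun x _ => ?_
      rw [Finset.mul_sum]
      exact Finset.sum_congr rfl fun y _ => by ring
    have h2 : ∑ x, ∑ y, C x y * (u x * v y) = ∑ y, v y * ∑ x, C x y * u x := by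
      rw [Finset.sum_comm]
      refine Finset.sum_congr rfl fun x _ => ?_
      rw [Finset.mul_sum]
      exact Finset.sum_congr rfl fun y _ => by ring
    rw [two_mul]
    nth_rewrite 1 [h1]
    rw [h2]
    simp only [dotProduct, Matrix.mulVec, Fintype.sum_sum_type, Sum.elim_inl,
      Sum.elim_inr, Pi.star_apply, star_trivial, mul_add, Finset.sum_add_distrib]
    simp only [Matrix.fromBlocks_apply₁₁, Matrix.fromBlocks_apply₁₂, Matrix.fromBlocks_apply₂₁,
      Matrix.fromBlocks_apply₂₂, Matrix.transpose_apply,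
      Matrix.diagonal_apply, ite_mul, zero_mul, Finset.sum_ite_eq,
      Finset.mem_univ, if_true]
    have e1 : ∑ x, u x * (l x * u x) = ∑ x, l x * u x ^ 2 :=
      Finset.sum_congr rfl fun x _ => by ring
    have e2 : ∑ x, v x * (k x * v x) = ∑ x, k x * v x ^ 2 :=
      Finset.sum_congr rfl fun x _ => by ring
    rw [e1, e2]; ring
  constructor
  · intro h u v
    rw [← key]; exact h.dotProduct_mulVec_nonneg _
  · intro h
    refine Matrix.PosSemidef.of_dotProduct_mulVec_nonneg ?_ ?_
    · rw [Matrix.IsHermitian, Matrix.fromBlocks_conjTranspose]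
      congr 1 <;> ext i j <;> simp [Matrix.diagonal_apply] 
      all_goals (by_cases hij : i = j <;> simp [hij, eq_comm])
    · intro w
      have : w = Sum.elim (fun x => w (Sum.inl x)) (fun y => w (Sum.inr y)) := by
        ext i; cases i <;> rfl
      rw [this, key]; exact h _ _

lemma gts_bdd {X Y : Type*} [Fintype X] [Fintype Y] (C : Matrix X Y ℝ) :
    BddAbove {r : ℝ | ∃ (d : ℕ) (a : X → Fin d → ℝ) (b : Y → Fin d → ℝ),
    1 ≤ d ∧ (∀ x, ∑ i, a x i ^ 2 = 1) ∧ (∀ y, ∑ i, b y i ^ 2 = 1) ∧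
    r = |∑ x, ∑ y, C x y * ∑ i, a x i * b y i|} := by
  refine ⟨∑ x, ∑ y, |C x y|, ?_⟩
  rintro r ⟨d, a, b, -, ha, hb, rfl⟩
  refine (Finset.abs_sum_le_sum_abs _ _).trans (Finset.sum_le_sum fun x _ => ?_)
  refine (Finset.abs_sum_le_sum_abs _ _).trans (Finset.sum_le_sum fun y _ => ?_)
  rw [abs_mul]
  refine mul_le_of_le_one_right (abs_nonneg _) ?_
  have h := Finset.sum_mul_sq_le_sq_mul_sq Finset.univ (a x) (b y)
  rw [ha, hb] at h
  exact abs_le_one_iff_mul_self_le_one.mpr (by nlinarith)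

lemma gts_nonneg {X Y : Type*} [Fintype X] [Fintype Y] (C : Matrix X Y ℝ) :
    0 ≤ gammaTwoStar C := by
  refine Real.sSup_nonneg ?_
  rintro r ⟨d, a, b, -, ha, hb, rfl⟩
  exact abs_nonneg _

/-- version with arbitrary finite index type -/
lemma gts_le {X Y I : Type*} [Fintype X] [Fintype Y] [Fintype I] [Nonempty I] (C : Matrix X Y ℝ)
    (a : X → I → ℝ) (b : Y → I → ℝ)
    (ha : ∀ x, ∑ i, a x i ^ 2 = 1) (hb : ∀ y, ∑ i, b y i ^ 2 = 1) :
    |∑ x, ∑ y, C x y * ∑ i, a x i * b y i| ≤ gammaTwoStar C := by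
  refine le_csSup (gts_bdd C) ?_
  let e := (Fintype.equivFin I).symm
  refine ⟨Fintype.card I, fun x i => a x (e i), fun y i => b y (e i), Fintype.card_pos, ?_, ?_, ?_⟩
  · intro x; rw [← ha x]; exact Equiv.sum_comp e (fun i => a x i ^ 2)
  · intro y; rw [← hb y]; exact Equiv.sum_comp e (fun i => b y i ^ 2)
  · congr 1
    refine Finset.sum_congr rfl fun x _ => Finset.sum_congr rfl fun y _ => ?_
    congr 1
    exact (Equiv.sum_comp e (fun i => a x i * b y i)).symm

lemma nonpos_of_deriv (f : ℝ → ℝ) (f' : ℝ) (hf : HasDerivAt f f' 0)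
    (h : ∀ s, 0 < s → f s ≤ f 0) : f' ≤ 0 := by
  have := hf.tendsto_slope_zero_right
  refine le_of_tendsto this ?_
  filter_upwards [self_mem_nhdsWithin] with s hs
  have hs : 0 < s := hs
  have := h s hs
  simp only [zero_add, smul_eq_mul]
  exact mul_nonpos_of_nonneg_of_nonpos (inv_nonneg.mpr hs.le) (by linarith)

lemma deriv_g (w : ℝ) : HasDerivAt (fun s : ℝ => (√(1 + s * w ^ 2))⁻¹) (-(w ^ 2 / 2)) 0 := by
  have h1 : HasDerivAt (fun s : ℝ => 1 + s * w ^ 2) (w ^ 2) 0 := by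
    simpa using ((hasDerivAt_id (0 : ℝ)).mul_const (w ^ 2)).const_add 1
  have h2 := (h1.sqrt (by simp)).fun_inv (by simp)
  refine h2.congr_deriv ?_
  simp
  try ring

lemma deriv_term (c M u v : ℝ) :
    HasDerivAt (fun s : ℝ => c * ((M + s * (u * v)) * (√(1 + s * u ^ 2))⁻¹ * (√(1 + s * v ^ 2))⁻¹))
      (c * (u * v - M * (u ^ 2 + v ^ 2) / 2)) 0 := by
  have h1 : HasDerivAt (fun s : ℝ => M + s * (u * v)) (u * v) 0 := by
    simpa using ((hasDerivAt_id (0 : ℝ)).mul_const (u * v)).const_add M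
  have h := ((h1.fun_mul (deriv_g u)).fun_mul (deriv_g v)).const_mul c
  refine h.congr_deriv ?_
  simp only [zero_mul, add_zero, Real.sqrt_one, inv_one]
  ring

lemma compact_rows {I J : Type*} [Fintype I] [Fintype J] :
    IsCompact {B : I → J → ℝ | ∀ i, ∑ k, B i k ^ 2 = 1} := by
  have hsub : {B : I → J → ℝ | ∀ i, ∑ k, B i k ^ 2 = 1} ⊆
      Set.Icc (fun _ _ => -1) (fun _ _ => 1) := by
    intro B hB
    have : ∀ i j, |B i j| ≤ 1 := by
      intro i j
      have h := Finset.single_le_sum (f := fun k => B i k ^ 2) (fun k _ => sq_nonneg _)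
        (Finset.mem_univ j)
      rw [hB i] at h
      exact abs_le_one_iff_mul_self_le_one.mpr (by simpa [sq] using h)
    exact ⟨fun i j => (abs_le.mp (this i j)).1, fun i j => (abs_le.mp (this i j)).2⟩
  refine IsCompact.of_isClosed_subset isCompact_Icc ?_ hsub
  rw [Set.ofPred_forall]
  refine isClosed_iInter fun i => isClosed_eq ?_ continuous_const
  fun_prop

open Matrix in
/-- perturbed unit rows -/
lemma perturb {I : Type*} [Fintype I] [DecidableEq I] (B : I → I → ℝ)
    (hB : ∀ i, ∑ k, B i k ^ 2 = 1) (w : I → ℝ) (s : ℝ) (hs : 0 < s) :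
    ∃ B' : I → I → ℝ, (∀ i, ∑ k, B' i k ^ 2 = 1) ∧
      ∀ i j, ∑ k, B' i k * B' j k =
        (∑ k, B i k * B j k + s * (w i * w j)) * (√(1 + s * w i ^ 2))⁻¹ * (√(1 + s * w j ^ 2))⁻¹ := by
  let A : Matrix (I ⊕ Unit) I ℝ := Matrix.of fun k i =>
    (Sum.elim (fun k => B i k) (fun _ => √s * w i) k) * (√(1 + s * w i ^ 2))⁻¹
  have hA : (Aᴴ * A).PosSemidef := Matrix.posSemidef_conjTranspose_mul_self A
  obtain ⟨D, hD⟩ : ∃ D : Matrix I I ℝ, Aᴴ * A = star D * D := by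
    open scoped MatrixOrder Matrix.Norms.L2Operator in
    exact CStarAlgebra.nonneg_iff_eq_star_mul_self.mp hA.nonneg
  have key : ∀ i j, ∑ k, D k i * D k j =
        (∑ k, B i k * B j k + s * (w i * w j)) * (√(1 + s * w i ^ 2))⁻¹ * (√(1 + s * w j ^ 2))⁻¹ := by
    intro i j
    have h1 := congrFun (congrFun hD i) j
    simp only [Matrix.star_eq_conjTranspose, Matrix.mul_apply, Matrix.conjTranspose_apply,
      star_trivial] at h1
    rw [← h1]
    simp only [A, Fintype.sum_sum_type, Matrix.of_apply, Sum.elim_inl, Sum.elim_inr,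
      Finset.univ_unique, Finset.sum_singleton]
    have hss : √s * √s = s := Real.mul_self_sqrt hs.le
    rw [add_mul, add_mul, Finset.sum_mul, Finset.sum_mul]
    congr 1
    · exact Finset.sum_congr rfl fun k _ => by ring
    · rw [← hss]
      simp only [hss]
      linear_combination (w i * w j * (√(1 + s * w i ^ 2))⁻¹ * (√(1 + s * w j ^ 2))⁻¹) * hss
  refine ⟨fun i k => D k i, fun i => ?_, key⟩
  have h := key i i
  have h2 : ∑ k, D k i ^ 2 = ∑ k, D k i * D k i := Finset.sum_congr rfl fun k _ => by ring
  have h3 : ∑ k, B i k * B i k = 1 := by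
    rw [← hB i]; exact Finset.sum_congr rfl fun k _ => by ring
  rw [h2, h, h3]
  have hp : 0 < 1 + s * w i ^ 2 := by positivity
  have := Real.mul_self_sqrt hp.le
  have hq := Real.sqrt_pos.mpr hp
  rw [mul_assoc, ← mul_inv, this, show s * (w i * w i) = s * w i ^ 2 by ring]
  exact mul_inv_cancel₀ hp.ne'

lemma dual_exists {X Y : Type*} [Fintype X] [Fintype Y] [DecidableEq X] [DecidableEq Y]
    (C : Matrix X Y ℝ) :
    ∃ (t : ℝ) (l : X → ℝ) (k : Y → ℝ), t ≤ gammaTwoStar C ∧ 0 ≤ t ∧ ∑ x, l x = t ∧ ∑ y, k y = t ∧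
      ∀ (u : X → ℝ) (v : Y → ℝ),
      0 ≤ ∑ x, l x * u x ^ 2 + ∑ y, k y * v y ^ 2 + 2 * ∑ x, ∑ y, C x y * (u x * v y) := by
  let F : (X ⊕ Y → X ⊕ Y → ℝ) → ℝ := fun B =>
    ∑ x, ∑ y, C x y * ∑ i, B (Sum.inl x) i * B (Sum.inr y) i
  have hF : Continuous F := by fun_prop
  obtain ⟨B, hB, hmax⟩ := (compact_rows (I := X ⊕ Y) (J := X ⊕ Y)).exists_isMaxOn
    ⟨fun i j => if i = j then 1 else 0, fun i => by simp⟩ hF.continuousOn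
  let M : X → Y → ℝ := fun x y => ∑ i, B (Sum.inl x) i * B (Sum.inr y) i
  have hu : ∀ (u : X → ℝ) (v : Y → ℝ),
      ∑ x, ∑ y, C x y * (u x * v y - M x y * (u x ^ 2 + v y ^ 2) / 2) ≤ 0 := by
    intro u v
    let f : ℝ → ℝ := fun s => ∑ x, ∑ y, C x y *
      ((M x y + s * (u x * v y)) * (√(1 + s * u x ^ 2))⁻¹ * (√(1 + s * v y ^ 2))⁻¹)
    have hf : HasDerivAt f
        (∑ x, ∑ y, C x y * (u x * v y - M x y * (u x ^ 2 + v y ^ 2) / 2)) 0 :=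
      HasDerivAt.fun_sum fun x _ => HasDerivAt.fun_sum fun y _ => deriv_term _ _ _ _
    refine nonpos_of_deriv f _ hf ?_
    intro s hs
    obtain ⟨B', hB', hk⟩ := perturb B hB (Sum.elim u v) s hs
    have h0 : f 0 = F B := by simp [f, F, M]
    have h1 : f s = F B' := by
      simp only [f, F, M, hk, Sum.elim_inl, Sum.elim_inr]
    rw [h0, h1]
    exact hmax hB'
  have hq : ∀ (u : X → ℝ) (v : Y → ℝ),
      0 ≤ ∑ x, (∑ y, C x y * M x y) * u x ^ 2 + ∑ y, (∑ x, C x y * M x y) * v y ^ 2 +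
        2 * ∑ x, ∑ y, C x y * (u x * v y) := by
    intro u v
    have h := hu u (fun y => - v y)
    have e1 : ∑ x, (∑ y, C x y * M x y) * u x ^ 2 = ∑ x, ∑ y, C x y * M x y * u x ^ 2 :=
      Finset.sum_congr rfl fun x _ => Finset.sum_mul _ _ _
    have e2 : ∑ y, (∑ x, C x y * M x y) * v y ^ 2 = ∑ x, ∑ y, C x y * M x y * v y ^ 2 := by
      rw [Finset.sum_comm]
      exact Finset.sum_congr rfl fun x _ => Finset.sum_mul _ _ _
    rw [e1, e2, Finset.mul_sum]
    simp_rw [Finset.mul_sum]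
    rw [← Finset.sum_add_distrib, ← Finset.sum_add_distrib]
    simp_rw [← Finset.sum_add_distrib]
    have : ∑ x, ∑ y, (C x y * M x y * u x ^ 2 + C x y * M x y * v y ^ 2 + 2 * (C x y * (u x * v y)))
      = -2 * ∑ x, ∑ y, C x y * (u x * (- v y) - M x y * (u x ^ 2 + (- v y) ^ 2) / 2) := by
      simp_rw [Finset.mul_sum]
      exact Finset.sum_congr rfl fun x _ => Finset.sum_congr rfl fun y _ => by ring
    rw [this]; linarith
  refine ⟨F B, fun x => ∑ y, C x y * M x y, fun y => ∑ x, C x y * M x y, ?_, ?_, rfl,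
    Finset.sum_comm, hq⟩
  · rcases isEmpty_or_nonempty (X ⊕ Y) with h | h
    · have : IsEmpty X := (isEmpty_sum.mp h).1
      simpa [F] using gts_nonneg C
    · exact (le_abs_self _).trans (gts_le C (fun x => B (Sum.inl x)) (fun y => B (Sum.inr y))
        (fun x => hB _) (fun y => hB _))
  · have h := hq (fun _ => 1) (fun _ => 0)
    simpa [F, M] using h

theorem stmt5 {n₁ m₁ n₂ m₂ : ℕ}
    (G₁ : Matrix (Fin n₁) (Fin m₁) ℝ) (G₂ : Matrix (Fin n₂) (Fin m₂) ℝ) :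
    gammaTwoStar
        (Matrix.of fun (x : Fin n₁ × Fin n₂) (y : Fin m₁ × Fin m₂) =>
          G₁ x.1 y.1 * G₂ x.2 y.2) =
      gammaTwoStar G₁ * gammaTwoStar G₂ := by
  apply le_antisymm
  · obtain ⟨t₁, l₁, k₁, ht₁, hp₁, hl₁, hk₁, hq₁⟩ := dual_exists G₁
    obtain ⟨t₂, l₂, k₂, ht₂, hp₂, hl₂, hk₂, hq₂⟩ := dual_exists G₂
    refine le_trans ?_ (mul_le_mul ht₁ ht₂ hp₂ (gts_nonneg _))
    have hP := (((psd_block _ _ _).mpr hq₁).kronecker ((psd_block _ _ _).mpr hq₂)).submatrix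
      (Sum.elim (fun x : Fin n₁ × Fin n₂ => (Sum.inl x.1, Sum.inl x.2))
        (fun y : Fin m₁ × Fin m₂ => (Sum.inr y.1, Sum.inr y.2)))
    have hP' : (Matrix.fromBlocks
        (Matrix.diagonal (fun x : Fin n₁ × Fin n₂ => l₁ x.1 * l₂ x.2))
        (Matrix.of fun (x : Fin n₁ × Fin n₂) (y : Fin m₁ × Fin m₂) => G₁ x.1 y.1 * G₂ x.2 y.2)
        (Matrix.of fun (x : Fin n₁ × Fin n₂) (y : Fin m₁ × Fin m₂) =>
          G₁ x.1 y.1 * G₂ x.2 y.2).transpose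
        (Matrix.diagonal (fun y : Fin m₁ × Fin m₂ => k₁ y.1 * k₂ y.2))).PosSemidef := by
      refine Eq.mp (congrArg Matrix.PosSemidef ?_) hP
      symm
      ext i j
      rcases i with ⟨i1, i2⟩ | ⟨i1, i2⟩ <;> rcases j with ⟨j1, j2⟩ | ⟨j1, j2⟩ <;>
        simp [Matrix.diagonal_apply, Matrix.kroneckerMap_apply]
      all_goals
        by_cases h1 : i1 = j1 <;> by_cases h2 : i2 = j2 <;> simp [h1, h2]
    have hq := (psd_block _ _ _).mp hP'
    have sl : ∑ x : Fin n₁ × Fin n₂, l₁ x.1 * l₂ x.2 = t₁ * t₂ := by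
      rw [← hl₁, ← hl₂, Finset.sum_mul_sum, Fintype.sum_prod_type]
    have sk : ∑ x : Fin m₁ × Fin m₂, k₁ x.1 * k₂ x.2 = t₁ * t₂ := by
      rw [← hk₁, ← hk₂, Finset.sum_mul_sum, Fintype.sum_prod_type]
    generalize (Matrix.of fun (x : Fin n₁ × Fin n₂) (y : Fin m₁ × Fin m₂) =>
          G₁ x.1 y.1 * G₂ x.2 y.2) = C at hq ⊢
    have main : ∀ (d : ℕ) (a : Fin n₁ × Fin n₂ → Fin d → ℝ) (b : Fin m₁ × Fin m₂ → Fin d → ℝ),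
        (∀ x, ∑ i, a x i ^ 2 = 1) → (∀ y, ∑ i, b y i ^ 2 = 1) →
        -(t₁ * t₂) ≤ ∑ x, ∑ y, C x y * ∑ i, a x i * b y i := by
      intro d a b ha hb
      have h := Finset.sum_nonneg (s := Finset.univ) fun (i : Fin d) _ =>
        hq (fun x => a x i) (fun y => b y i)
      rw [Finset.sum_add_distrib, Finset.sum_add_distrib, ← Finset.mul_sum] at h
      rw [Finset.sum_comm] at h
      simp_rw [← Finset.mul_sum, ha] at h
      rw [Finset.sum_comm (f := fun i y => k₁ y.1 * k₂ y.2 * b y i ^ 2)] at h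
      simp_rw [← Finset.mul_sum, hb, mul_one] at h
      rw [sl, sk] at h
      have e : ∑ x, ∑ y, C x y * ∑ i, a x i * b y i = ∑ i, ∑ x, ∑ y, C x y * (a x i * b y i) := by
        symm
        rw [Finset.sum_comm]
        refine Finset.sum_congr rfl fun x _ => ?_
        rw [Finset.sum_comm]
        exact Finset.sum_congr rfl fun y _ => (Finset.mul_sum _ _ _).symm
      rw [e]; linarith
    refine Real.sSup_le ?_ (mul_nonneg hp₁ hp₂)
    rintro r ⟨d, a, b, -, ha, hb, rfl⟩
    have h1 := main d a b ha hb
    have h2 := main d a (fun y i => - b y i) ha (by simpa using hb)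
    simp only [mul_neg, Finset.sum_neg_distrib] at h2
    exact abs_le.mpr ⟨h1, by linarith⟩
  · have hmul : ∀ r₁ ∈ {r : ℝ | ∃ (d : ℕ) (a : Fin n₁ → Fin d → ℝ) (b : Fin m₁ → Fin d → ℝ),
        1 ≤ d ∧ (∀ x, ∑ i, a x i ^ 2 = 1) ∧ (∀ y, ∑ i, b y i ^ 2 = 1) ∧
        r = |∑ x, ∑ y, G₁ x y * ∑ i, a x i * b y i|},
        ∀ r₂ ∈ {r : ℝ | ∃ (d : ℕ) (a : Fin n₂ → Fin d → ℝ) (b : Fin m₂ → Fin d → ℝ),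
        1 ≤ d ∧ (∀ x, ∑ i, a x i ^ 2 = 1) ∧ (∀ y, ∑ i, b y i ^ 2 = 1) ∧
        r = |∑ x, ∑ y, G₂ x y * ∑ i, a x i * b y i|},
        r₁ * r₂ ≤ gammaTwoStar (Matrix.of fun (x : Fin n₁ × Fin n₂) (y : Fin m₁ × Fin m₂) =>
          G₁ x.1 y.1 * G₂ x.2 y.2) := by
      rintro r₁ ⟨d, a, b, hd, ha, hb, rfl⟩ r₂ ⟨d', a', b', hd', ha', hb', rfl⟩
      have : Nonempty (Fin d) := ⟨⟨0, hd⟩⟩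
      have : Nonempty (Fin d') := ⟨⟨0, hd'⟩⟩
      refine le_of_eq_of_le ?_ (gts_le (I := Fin d × Fin d') _
        (fun x i => a x.1 i.1 * a' x.2 i.2) (fun y i => b y.1 i.1 * b' y.2 i.2) ?_ ?_)
      · rw [← abs_mul, Finset.sum_mul_sum, Fintype.sum_prod_type]
        congr 1
        refine Finset.sum_congr rfl fun x _ => Finset.sum_congr rfl fun x' _ => ?_
        rw [Finset.sum_mul_sum, Fintype.sum_prod_type]
        refine Finset.sum_congr rfl fun y _ => Finset.sum_congr rfl fun y' _ => ?_
        rw [mul_mul_mul_comm, Finset.sum_mul_sum, Fintype.sum_prod_type]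
        simp only [Matrix.of_apply]
        congr 1
        refine Finset.sum_congr rfl fun i _ => Finset.sum_congr rfl fun i' _ => by ring
      · intro x
        simp_rw [mul_pow]
        rw [Fintype.sum_prod_type]
        dsimp only
        rw [← Finset.sum_mul_sum, ha, ha', one_mul]
      · intro x
        simp_rw [mul_pow]
        rw [Fintype.sum_prod_type]
        dsimp only
        rw [← Finset.sum_mul_sum, hb, hb', one_mul]
    have g0 := gts_nonneg (Matrix.of fun (x : Fin n₁ × Fin n₂) (y : Fin m₁ × Fin m₂) =>
          G₁ x.1 y.1 * G₂ x.2 y.2)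
    have s1 : ∀ r₁ ∈ {r : ℝ | ∃ (d : ℕ) (a : Fin n₁ → Fin d → ℝ) (b : Fin m₁ → Fin d → ℝ),
        1 ≤ d ∧ (∀ x, ∑ i, a x i ^ 2 = 1) ∧ (∀ y, ∑ i, b y i ^ 2 = 1) ∧
        r = |∑ x, ∑ y, G₁ x y * ∑ i, a x i * b y i|},
        r₁ * gammaTwoStar G₂ ≤ gammaTwoStar
          (Matrix.of fun (x : Fin n₁ × Fin n₂) (y : Fin m₁ × Fin m₂) =>
          G₁ x.1 y.1 * G₂ x.2 y.2) := by
      intro r₁ hr₁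
      have hr0 : 0 ≤ r₁ := by
        obtain ⟨d, a, b, hd, ha, hb, rfl⟩ := hr₁
        exact abs_nonneg _
      rcases hr0.eq_or_lt with h | h
      · rw [← h, zero_mul]; exact g0
      · rw [mul_comm, ← le_div_iff₀ h]
        refine Real.sSup_le (fun r₂ hr₂ => ?_) (div_nonneg g0 h.le)
        rw [le_div_iff₀ h, mul_comm]
        exact hmul r₁ hr₁ r₂ hr₂
    rcases (gts_nonneg G₂).eq_or_lt with h | h
    · rw [← h, mul_zero]; exact g0
    · rw [← le_div_iff₀ h]
      refine Real.sSup_le (fun r₁ hr₁ => ?_) (div_nonneg g0 h.le)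
      rw [le_div_iff₀ h]
      exact s1 r₁ hr₁
end
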